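/- Let ω ∈ (0,1) be irrational. There exist constants K₁, K₂ > 0 and δ₀ ∈ (0,1), depending only on ω, with the following property: for every ρ > 0, every δ ∈ (0, min(ρ, δ₀)) and every a ∈ 𝒫₀(ρ), if Δ := (1+ω)δ satisfies 𝔅rj₁(Δ) < ∞ and 𝔅rj₂(2Δ) < ∞, then there exists g ∈ 𝒫₀(ρ−δ) with (∂_x + ω∂_y) g = a on Π(ρ−δ)² and ‖g‖_{ρ−δ} ≤ (4e^δ · 𝔅rj₁(Δ) + 2e^δ · 𝔅rj₂(2Δ) + K₁ δ^{−2} + K₂ δ^{−1} log(δ^{−1})) · ‖a‖_ρ. -/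

import Mathlib

open Real Complex
open scoped ENNReal

noncomputable section

/-- The open horizontal strip `Π(ρ) = {z ∈ ℂ : |Im z| < ρ}`. -/
def openStrip (ρ : ℝ) : Set ℂ := {z : ℂ | |z.im| < ρ}

/-- The closed horizontal strip `cl(Π(ρ)) = {z ∈ ℂ : |Im z| ≤ ρ}`. -/
def closedStrip (ρ : ℝ) : Set ℂ := {z : ℂ | |z.im| ≤ ρ}

/-- The Fourier basis function `e_{p,q}(x,y) = exp(i(px - qy))`. -/
def efun (p q : ℤ) (z : ℂ × ℂ) : ℂ :=
  Complex.exp (Complex.I * ((p : ℂ) * z.1 - (q : ℂ) * z.2))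

/-- Membership in the class `𝒫₀(ρ)`: continuous on the closed bi-strip, holomorphic on the
open bi-strip, `2π`-periodic in each variable, real-valued on `ℝ²`, with zero average. -/
structure MemP0 (ρ : ℝ) (b : ℂ × ℂ → ℂ) : Prop where
  contOn : ContinuousOn b (closedStrip ρ ×ˢ closedStrip ρ)
  diffOn : DifferentiableOn ℂ b (openStrip ρ ×ˢ openStrip ρ)
  periodic_fst : ∀ z : ℂ × ℂ, b (z.1 + 2 * Real.pi, z.2) = b z
  periodic_snd : ∀ z : ℂ × ℂ, b (z.1, z.2 + 2 * Real.pi) = b z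
  real_on_real : ∀ x y : ℝ, (b ((x : ℂ), (y : ℂ))).im = 0
  zero_avg : (∫ x in (0 : ℝ)..(2 * Real.pi), ∫ y in (0 : ℝ)..(2 * Real.pi),
    b ((x : ℂ), (y : ℂ))) = 0

/-- The sup norm `‖b‖_ρ` over the closed bi-strip. -/
def supNorm (ρ : ℝ) (b : ℂ × ℂ → ℂ) : ℝ :=
  ⨆ z : (closedStrip ρ ×ˢ closedStrip ρ : Set (ℂ × ℂ)), ‖b z‖

/-- The `(p,q)`-th Fourier coefficient
`b_{p,q} = (2π)⁻² ∫∫ b(x,y) e^{-i(px-qy)} dx dy`. -/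
def fcoeff (b : ℂ × ℂ → ℂ) (p q : ℤ) : ℂ :=
  (1 / (2 * Real.pi) ^ 2 : ℝ) *
    ∫ x in (0 : ℝ)..(2 * Real.pi), ∫ y in (0 : ℝ)..(2 * Real.pi),
      b ((x : ℂ), (y : ℂ)) * Complex.exp (-Complex.I * ((p : ℂ) * x - (q : ℂ) * y))

/-- The cohomological operator `(∂_x + ω ∂_y) g` at `z`. -/
def cohomOp (ω : ℝ) (g : ℂ × ℂ → ℂ) (z : ℂ × ℂ) : ℂ :=
  fderiv ℂ g z (1, 0) + (ω : ℂ) * fderiv ℂ g z (0, 1)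

end

noncomputable section

/-- The Gauss-map iterates of `ω`. -/
def cfX (ω : ℝ) : ℕ → ℝ
  | 0 => ω
  | n + 1 => Int.fract (cfX ω n)⁻¹

/-- The partial quotients of `ω`: for `n ≥ 1`, `cfA ω n = ⌊1 / x_{n-1}⌋`. -/
def cfA (ω : ℝ) : ℕ → ℕ
  | 0 => 0
  | n + 1 => (⌊(cfX ω n)⁻¹⌋).toNat

/-- Denominators of the convergents of `ω`. -/
def cfQ (ω : ℝ) : ℕ → ℕ
  | 0 => 1
  | 1 => cfA ω 1
  | n + 2 => cfA ω (n + 2) * cfQ ω (n + 1) + cfQ ω n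

/-- First Brjuno-like function `𝔅rj₁(Δ) = Σ_{n=1}^∞ e^{-q_n Δ} q_{n+1}`, valued in `[0,∞]`. -/
def Brj1 (ω Δ : ℝ) : ℝ≥0∞ :=
  ∑' n : ℕ, ENNReal.ofReal (Real.exp (-(cfQ ω (n + 1) : ℝ) * Δ) * (cfQ ω (n + 2) : ℝ))

/-- Second Brjuno-like function `𝔅rj₂(Δ) = Σ_{n=1}^∞ e^{-q_n Δ} q_{n+1} log a_{n+1}`. -/
def Brj2 (ω Δ : ℝ) : ℝ≥0∞ :=
  ∑' n : ℕ, ENNReal.ofReal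
    (Real.exp (-(cfQ ω (n + 1) : ℝ) * Δ) * (cfQ ω (n + 2) : ℝ) * Real.log (cfA ω (n + 2) : ℝ))

end

/-- Numerators of the convergents of `ω`. -/
noncomputable def cfP (ω : ℝ) : ℕ → ℕ
  | 0 => 0
  | 1 => 1
  | n + 2 => cfA ω (n + 2) * cfP ω (n + 1) + cfP ω n

section ContinuedFraction

variable {ω : ℝ}

lemma cfX_spec (hirr : Irrational ω) (hω0 : 0 < ω) (hω1 : ω < 1) (n : ℕ) :
    Irrational (cfX ω n) ∧ 0 < cfX ω n ∧ cfX ω n < 1 := by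
  induction n with
  | zero => exact ⟨hirr, hω0, hω1⟩
  | succ n ih =>
    have h : Irrational (cfX ω (n + 1)) := by
      show Irrational (Int.fract (cfX ω n)⁻¹)
      rw [Int.fract]
      exact ih.1.inv.sub_intCast _
    refine ⟨h, lt_of_le_of_ne (Int.fract_nonneg _) (Ne.symm h.ne_zero), Int.fract_lt_one _⟩

lemma inv_cfX (hirr : Irrational ω) (hω0 : 0 < ω) (hω1 : ω < 1) (n : ℕ) :
    (cfX ω n)⁻¹ = cfA ω (n + 1) + cfX ω (n + 1) := by
  have h := cfX_spec hirr hω0 hω1 n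
  have h0 : 0 ≤ ⌊(cfX ω n)⁻¹⌋ := Int.floor_nonneg.2 (inv_nonneg.2 h.2.1.le)
  have h1 : ((cfA ω (n + 1) : ℕ) : ℝ) = (⌊(cfX ω n)⁻¹⌋ : ℝ) := by
    show (((⌊(cfX ω n)⁻¹⌋).toNat : ℕ) : ℝ) = _
    exact_mod_cast congrArg (Int.cast : ℤ → ℝ) (Int.toNat_of_nonneg h0)
  rw [h1]
  exact (Int.floor_add_fract _).symm

lemma one_le_cfA (hirr : Irrational ω) (hω0 : 0 < ω) (hω1 : ω < 1) (n : ℕ) :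
    1 ≤ cfA ω (n + 1) := by
  have h := cfX_spec hirr hω0 hω1 n
  have h1 := (cfX_spec hirr hω0 hω1 (n + 1)).2.2
  have h2 : 1 < (cfX ω n)⁻¹ := (one_lt_inv₀ h.2.1).2 h.2.2
  rw [inv_cfX hirr hω0 hω1] at h2
  have : (0 : ℝ) < cfA ω (n + 1) := by linarith
  exact_mod_cast this

lemma one_le_cfQ (hirr : Irrational ω) (hω0 : 0 < ω) (hω1 : ω < 1) :
    ∀ n : ℕ, 1 ≤ cfQ ω n
  | 0 => le_rfl
  | 1 => one_le_cfA hirr hω0 hω1 0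
  | n + 2 => by
    rw [cfQ]
    exact (one_le_cfQ hirr hω0 hω1 n).trans (Nat.le_add_left _ _)

lemma cfA_mul_cfQ_le (n : ℕ) : cfA ω (n + 1) * cfQ ω n ≤ cfQ ω (n + 1) := by
  cases n with
  | zero => simp [cfQ]
  | succ n => rw [cfQ]; exact Nat.le_add_right _ _

lemma cfQ_le_succ (hirr : Irrational ω) (hω0 : 0 < ω) (hω1 : ω < 1) (n : ℕ) :
    cfQ ω n ≤ cfQ ω (n + 1) :=
  (Nat.le_mul_of_pos_left _ (one_le_cfA hirr hω0 hω1 n)).trans (cfA_mul_cfQ_le n)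

lemma le_cfQ (hirr : Irrational ω) (hω0 : 0 < ω) (hω1 : ω < 1) :
    ∀ n : ℕ, n ≤ cfQ ω n
  | 0 => Nat.zero_le _
  | 1 => one_le_cfQ hirr hω0 hω1 1
  | n + 2 => by
    have h1 := le_cfQ hirr hω0 hω1 (n + 1)
    have h2 := one_le_cfQ hirr hω0 hω1 n
    have h3 : cfQ ω (n + 1) ≤ cfA ω (n + 2) * cfQ ω (n + 1) :=
      Nat.le_mul_of_pos_left _ (one_le_cfA hirr hω0 hω1 (n + 1))
    rw [cfQ]
    omega

lemma cfP_mul_cfQ_sub (n : ℕ) :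
    (cfP ω (n + 1) : ℤ) * cfQ ω n - cfP ω n * cfQ ω (n + 1) = (-1) ^ n := by
  induction n with
  | zero => simp [cfP, cfQ]
  | succ n ih =>
    rw [pow_succ, ← ih, cfP, cfQ]
    push_cast
    ring

/-- Successive approximation errors are related by `D_{n+1} = -x_{n+1} D_n`. -/
lemma cfQ_mul_sub_cfP_succ (hirr : Irrational ω) (hω0 : 0 < ω) (hω1 : ω < 1) (n : ℕ) :
    (cfQ ω (n + 1) : ℝ) * ω - cfP ω (n + 1)
      = -cfX ω (n + 1) * ((cfQ ω n : ℝ) * ω - cfP ω n) := by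
  induction n with
  | zero =>
    have h := inv_cfX hirr hω0 hω1 0
    have : cfX ω 0 = ω := rfl
    rw [this] at h
    have h2 : 1 = ((cfA ω 1 : ℝ) + cfX ω 1) * ω := by
      rw [← h, inv_mul_cancel₀ hω0.ne']
    simp only [zero_add, cfQ, cfP, Nat.cast_one, Nat.cast_zero]
    linarith
  | succ n ih =>
    have h := inv_cfX hirr hω0 hω1 (n + 1)
    have hx := (cfX_spec hirr hω0 hω1 (n + 1)).2.1
    have h2 : 1 = ((cfA ω (n + 2) : ℝ) + cfX ω (n + 2)) * cfX ω (n + 1) := by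
      rw [← h, inv_mul_cancel₀ hx.ne']
    rw [show n + 1 + 1 = n + 2 from rfl]
    rw [cfQ, cfP]
    push_cast
    rw [ih]
    have e : ((cfA ω (n + 2) : ℝ) * cfQ ω (n + 1) + cfQ ω n) * ω
        - (cfA ω (n + 2) * cfP ω (n + 1) + cfP ω n)
        = cfA ω (n + 2) * ((cfQ ω (n + 1) : ℝ) * ω - cfP ω (n + 1))
          + ((cfQ ω n : ℝ) * ω - cfP ω n) := by ring
    rw [e, ih]
    linear_combination ((cfQ ω n : ℝ) * ω - cfP ω n) * h2

lemma abs_cfQ_mul_sub_cfP (hirr : Irrational ω) (hω0 : 0 < ω) (hω1 : ω < 1) (n : ℕ) :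
    |(cfQ ω n : ℝ) * ω - cfP ω n| * (cfQ ω (n + 1) + cfX ω (n + 1) * cfQ ω n) = 1 := by
  have hx := (cfX_spec hirr hω0 hω1 (n + 1)).2.1
  have h : ((cfQ ω n : ℝ) * ω - cfP ω n) * (cfQ ω (n + 1) + cfX ω (n + 1) * cfQ ω n)
      = (-1) ^ n := by
    have h1 := cfQ_mul_sub_cfP_succ hirr hω0 hω1 n
    have h2 : ((cfP ω (n + 1) : ℝ) * cfQ ω n - cfP ω n * cfQ ω (n + 1)) = (-1) ^ n := by
      exact_mod_cast congrArg (Int.cast : ℤ → ℝ) (cfP_mul_cfQ_sub (ω := ω) n)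
    linear_combination h2 + (cfQ ω n : ℝ) * h1
  have h3 : (0 : ℝ) ≤ cfQ ω (n + 1) + cfX ω (n + 1) * cfQ ω n := by positivity
  rw [← abs_of_nonneg h3, ← abs_mul, h, abs_pow, abs_neg, abs_one, one_pow]

lemma exists_cfQ_le_lt (hirr : Irrational ω) (hω0 : 0 < ω) (hω1 : ω < 1) {q : ℤ} (hq : 1 ≤ q) :
    ∃ n, (cfQ ω n : ℤ) ≤ q ∧ q < cfQ ω (n + 1) := by
  classical
  have hex : ∃ n, q < cfQ ω (n + 1) := by
    refine ⟨q.toNat, ?_⟩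
    have := le_cfQ hirr hω0 hω1 (q.toNat + 1)
    omega
  refine ⟨Nat.find hex, ?_, Nat.find_spec hex⟩
  rcases h : Nat.find hex with _ | m
  · simpa [cfQ] using hq
  · exact not_lt.1 (Nat.find_min hex (m := m) (by omega))

/-- Convergents are best approximations of the second kind. -/
lemma abs_cfQ_mul_sub_cfP_le (hirr : Irrational ω) (hω0 : 0 < ω) (hω1 : ω < 1) {n : ℕ}
    {p q : ℤ} (hq : 1 ≤ q) (hqn : q < cfQ ω (n + 1)) :
    |(cfQ ω n : ℝ) * ω - cfP ω n| ≤ |(q : ℝ) * ω - p| := by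
  have hx := (cfX_spec hirr hω0 hω1 (n + 1)).2.1
  have hdet := cfP_mul_cfQ_sub (ω := ω) n
  set ε : ℤ := (-1) ^ n with hε
  have hεε : ε * ε = 1 := by rw [hε, ← mul_pow]; norm_num
  set u : ℤ := ε * (q * cfP ω (n + 1) - p * cfQ ω (n + 1)) with hu
  set v : ℤ := ε * (p * cfQ ω n - q * cfP ω n) with hv
  have hqe : q = u * cfQ ω n + v * cfQ ω (n + 1) := by
    rw [hu, hv]; linear_combination (-q) * hεε - q * ε * hdet
  have hpe : p = u * cfP ω n + v * cfP ω (n + 1) := by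
    rw [hu, hv]; linear_combination (-p) * hεε - p * ε * hdet
  have hval : (q : ℝ) * ω - p = ((cfQ ω n : ℝ) * ω - cfP ω n) * (u - cfX ω (n + 1) * v) := by
    have h1 := cfQ_mul_sub_cfP_succ hirr hω0 hω1 n
    have hq' : (q : ℝ) = u * cfQ ω n + v * cfQ ω (n + 1) := by exact_mod_cast hqe
    have hp' : (p : ℝ) = u * cfP ω n + v * cfP ω (n + 1) := by exact_mod_cast hpe
    rw [hq', hp']
    linear_combination (v : ℝ) * h1
  have hQ : (1 : ℤ) ≤ cfQ ω n := by exact_mod_cast one_le_cfQ hirr hω0 hω1 n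
  have hQ' : (1 : ℤ) ≤ cfQ ω (n + 1) := by exact_mod_cast one_le_cfQ hirr hω0 hω1 (n + 1)
  have key : 1 ≤ |(u : ℝ) - cfX ω (n + 1) * v| := by
    rcases lt_trichotomy v 0 with hv0 | hv0 | hv0
    · have hu1 : 1 ≤ u := by
        by_contra hcon
        nlinarith
      have hu1' : (1 : ℝ) ≤ u := by exact_mod_cast hu1
      have hv1' : (v : ℝ) ≤ 0 := by exact_mod_cast hv0.le
      refine le_trans ?_ (le_abs_self _)
      nlinarith
    · have hu1 : u ≠ 0 := by
        rintro h
        rw [h, hv0] at hqe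
        omega
      rw [hv0]
      simpa using (by exact_mod_cast Int.one_le_abs hu1 : (1 : ℝ) ≤ |(u : ℝ)|)
    · have hu1 : u ≤ -1 := by
        by_contra hcon
        have : 0 ≤ u := by omega
        nlinarith
      have hu1' : (u : ℝ) ≤ -1 := by exact_mod_cast hu1
      have hv1' : (0 : ℝ) ≤ v := by exact_mod_cast hv0.le
      refine le_trans ?_ (neg_le_abs _)
      nlinarith
  rw [hval, abs_mul]
  exact le_mul_of_one_le_right (abs_nonneg _) key

/-- A form of Legendre's criterion: a good rational approximation is a multiple of a
convergent. -/
lemma eq_mul_convergent_of_abs_lt (hirr : Irrational ω) (hω0 : 0 < ω) (hω1 : ω < 1)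
    {p q : ℤ} (hq : 1 ≤ q) (h1 : |(q : ℝ) * ω - p| < ω)
    (h2 : |(q : ℝ) * ω - p| < 1 / (2 * q)) :
    ∃ n k : ℕ, 1 ≤ k ∧ k ≤ cfA ω (n + 2) ∧ q = k * cfQ ω (n + 1) ∧ p = k * cfP ω (n + 1) := by
  obtain ⟨n, hn1, hn2⟩ := exists_cfQ_le_lt hirr hω0 hω1 hq
  have hbest := abs_cfQ_mul_sub_cfP_le hirr hω0 hω1 (p := p) hq hn2
  rcases n with _ | n
  · simp only [cfQ, cfP, Nat.cast_one, one_mul, Nat.cast_zero, sub_zero, abs_of_pos hω0] at hbest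
    exact absurd h1 (not_lt.2 hbest)
  have hq' : (1 : ℝ) ≤ q := by exact_mod_cast hq
  have hQ : (1 : ℤ) ≤ cfQ ω (n + 1) := by exact_mod_cast one_le_cfQ hirr hω0 hω1 (n + 1)
  have hcross : p * cfQ ω (n + 1) - q * cfP ω (n + 1) = 0 := by
    rw [← Int.abs_lt_one_iff]
    have e : ((p * cfQ ω (n + 1) - q * cfP ω (n + 1) : ℤ) : ℝ)
        = q * ((cfQ ω (n + 1) : ℝ) * ω - cfP ω (n + 1)) - cfQ ω (n + 1) * (q * ω - p) := by
      push_cast; ring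
    have hle : (cfQ ω (n + 1) : ℝ) ≤ q := by exact_mod_cast hn1
    have : |((p * cfQ ω (n + 1) - q * cfP ω (n + 1) : ℤ) : ℝ)| < 1 := by
      rw [e]
      calc _ ≤ |q * ((cfQ ω (n + 1) : ℝ) * ω - cfP ω (n + 1))|
            + |cfQ ω (n + 1) * ((q : ℝ) * ω - p)| := abs_sub _ _
        _ = q * |(cfQ ω (n + 1) : ℝ) * ω - cfP ω (n + 1)|
            + cfQ ω (n + 1) * |(q : ℝ) * ω - p| := by
          rw [abs_mul, abs_mul, abs_of_nonneg (by linarith : (0 : ℝ) ≤ q), Nat.abs_cast]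
        _ ≤ q * |(q : ℝ) * ω - p| + q * |(q : ℝ) * ω - p| := by gcongr
        _ = 2 * q * |(q : ℝ) * ω - p| := by ring
        _ < 2 * q * (1 / (2 * q)) := by gcongr
        _ = 1 := by field_simp
    exact_mod_cast this
  have hdet := cfP_mul_cfQ_sub (ω := ω) (n + 1)
  set ε : ℤ := (-1) ^ (n + 1) with hε
  have hεε : ε * ε = 1 := by rw [hε, ← mul_pow]; norm_num
  set u : ℤ := ε * (q * cfP ω (n + 2) - p * cfQ ω (n + 2)) with hu
  rw [show n + 1 + 1 = n + 2 from rfl] at hdet hn2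
  have hqe : q = u * cfQ ω (n + 1) := by
    rw [hu]; linear_combination (-q) * hεε - q * ε * hdet + ε * cfQ ω (n + 2) * hcross
  have hpe : p = u * cfP ω (n + 1) := by
    rw [hu]; linear_combination (-p) * hεε - p * ε * hdet + ε * cfP ω (n + 2) * hcross
  have hu1 : 1 ≤ u := by
    by_contra hcon
    nlinarith
  have hQQ : (cfQ ω n : ℤ) ≤ cfQ ω (n + 1) := by exact_mod_cast cfQ_le_succ hirr hω0 hω1 n
  have hrec : (cfQ ω (n + 2) : ℤ) = cfA ω (n + 2) * cfQ ω (n + 1) + cfQ ω n := by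
    rw [cfQ]; push_cast; rfl
  have hu2 : u ≤ cfA ω (n + 2) := by
    by_contra hcon
    have : (cfA ω (n + 2) : ℤ) + 1 ≤ u := by omega
    nlinarith
  lift u to ℕ using by omega with k
  exact ⟨n, k, by omega, by omega, hqe, hpe⟩

end ContinuedFraction

section SmallDivisors

/-- The size of the `(p, q)`-th term of the series solving the cohomological equation. -/
noncomputable def divisorWeight (ω δ : ℝ) (x : ℤ × ℤ) : ℝ :=
  Real.exp (-δ * (|(x.1 : ℝ)| + |(x.2 : ℝ)|)) / |(x.1 : ℝ) + ω * x.2|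

variable {ω δ : ℝ}

lemma divisorWeight_nonneg (x : ℤ × ℤ) : 0 ≤ divisorWeight ω δ x := by
  unfold divisorWeight; positivity

lemma divisorWeight_neg (x : ℤ × ℤ) : divisorWeight ω δ (-x) = divisorWeight ω δ x := by
  unfold divisorWeight
  have : (((-x).1 : ℤ) : ℝ) + ω * ((-x).2 : ℤ) = -((x.1 : ℝ) + ω * x.2) := by
    push_cast [Prod.fst_neg, Prod.snd_neg]; ring
  rw [this, abs_neg]
  simp

lemma summable_exp_neg_mul_abs (hδ : 0 < δ) :
    Summable fun p : ℤ => Real.exp (-δ * |(p : ℝ)|) := by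
  have h : Summable fun n : ℕ => Real.exp (-δ * n) := by
    have := Real.summable_exp_nat_mul_iff.2 (neg_lt_zero.2 hδ)
    simpa [mul_comm] using this
  exact Summable.of_nat_of_neg (by simpa using h) (by simpa using h)

lemma tsum_exp_neg_mul_abs_le (hδ : 0 < δ) (hδ1 : δ ≤ 1) :
    ∑' p : ℤ, Real.exp (-δ * |(p : ℝ)|) ≤ 4 / δ := by
  set r := Real.exp (-δ) with hr
  have hr0 : 0 < r := Real.exp_pos _
  have hr1 : r < 1 := Real.exp_lt_one_iff.2 (by linarith)
  have hpow : ∀ n : ℕ, Real.exp (-δ * n) = r ^ n := fun n => by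
    rw [hr, ← Real.exp_nat_mul, mul_comm]
  have hgeom := hasSum_geometric_of_lt_one hr0.le hr1
  set f : ℤ → ℝ := fun p => Real.exp (-δ * |(p : ℝ)|) with hf
  have h1 : HasSum (fun n : ℕ => f n) (1 - r)⁻¹ := by
    have e : (fun n : ℕ => f n) = fun n => r ^ n := by
      funext n
      rw [← hpow, hf]
      simp
    rwa [e]
  have h2 : HasSum (fun n : ℕ => f (-((n : ℤ) + 1))) (r * (1 - r)⁻¹) := by
    have e : (fun n : ℕ => f (-((n : ℤ) + 1))) = fun n => r * r ^ n := by
      funext n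
      rw [← pow_succ', ← hpow, hf]
      simp only [Int.cast_neg, abs_neg]
      push_cast
      rw [abs_of_nonneg (by positivity)]
    rw [e]
    exact hgeom.mul_left r
  rw [(HasSum.of_nat_of_neg_add_one h1 h2).tsum_eq]
  have h3 : δ / 2 ≤ 1 - r := by
    have h4 : r * (1 + δ) ≤ 1 := by
      have h5 := Real.add_one_le_exp δ
      have h6 : r * Real.exp δ = 1 := by rw [hr, ← Real.exp_add]; simp
      nlinarith
    nlinarith
  have h4 : (1 - r)⁻¹ ≤ 2 / δ := by
    rw [inv_le_comm₀ (by linarith) (by positivity), inv_div]; exact h3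
  have h5 : r * (1 - r)⁻¹ ≤ 1 * (2 / δ) := by
    gcongr
  calc _ ≤ 2 / δ + 1 * (2 / δ) := add_le_add h4 h5
    _ = 4 / δ := by ring

lemma tsum_ofReal_exp_neg_mul_abs_le (hδ : 0 < δ) (hδ1 : δ ≤ 1) :
    ∑' p : ℤ, ENNReal.ofReal (Real.exp (-δ * |(p : ℝ)|)) ≤ ENNReal.ofReal (4 / δ) := by
  rw [← ENNReal.ofReal_tsum_of_nonneg (fun _ => (Real.exp_pos _).le)
    (summable_exp_neg_mul_abs hδ)]
  exact ENNReal.ofReal_le_ofReal (tsum_exp_neg_mul_abs_le hδ hδ1)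

/-- The common bound for the terms carried by the multiples of a convergent. -/
noncomputable def convergentWeight (ω δ : ℝ) (n k : ℕ) : ℝ :=
  Real.exp δ * Real.exp (-(k * cfQ ω (n + 1)) * ((1 + ω) * δ))
    * ((cfQ ω (n + 1) + cfQ ω (n + 2)) / k)

lemma divisorWeight_le_of_pos (hirr : Irrational ω) (hω0 : 0 < ω) (hω1 : ω < 1) (hδ : 0 < δ)
    {p q : ℤ} (hq : 1 ≤ q) (hpq : |(p : ℝ) + ω * q| < 1 / 2) :
    divisorWeight ω δ (p, q) ≤ (1 / ω + 2 * |(q : ℝ)|) * Real.exp (-δ * |(q : ℝ)|) ∨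
    ∃ n k : ℕ, k ∈ Finset.Icc 1 (cfA ω (n + 2)) ∧
      (p, q) = (-(k * cfP ω (n + 1) : ℤ), (k * cfQ ω (n + 1) : ℤ)) ∧
      divisorWeight ω δ (p, q) ≤ convergentWeight ω δ n k := by
  have hq' : (1 : ℝ) ≤ q := by exact_mod_cast hq
  have habs : |(q : ℝ)| = q := abs_of_pos (by linarith)
  have hexp : Real.exp (-δ * (|(p : ℝ)| + |(q : ℝ)|)) ≤ Real.exp (-δ * |(q : ℝ)|) := by
    apply Real.exp_le_exp.2
    nlinarith [abs_nonneg (p : ℝ)]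
  have ht : |(q : ℝ) * ω - ((-p : ℤ) : ℝ)| = |(p : ℝ) + ω * q| := by
    congr 1; push_cast; ring
  have hnear : ∀ c : ℝ, 0 < c → 1 / c ≤ |(p : ℝ) + ω * q| → c ≤ 1 / ω + 2 * |(q : ℝ)| →
      divisorWeight ω δ (p, q) ≤ (1 / ω + 2 * |(q : ℝ)|) * Real.exp (-δ * |(q : ℝ)|) := by
    intro c hc h1 h2
    have h3 : 0 < |(p : ℝ) + ω * q| := lt_of_lt_of_le (by positivity) h1
    unfold divisorWeight
    rw [div_le_iff₀ h3]
    have h4 : 1 ≤ c * |(p : ℝ) + ω * q| := by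
      rw [div_le_iff₀ hc] at h1; linarith
    calc _ ≤ Real.exp (-δ * |(q : ℝ)|) * 1 := by simpa using hexp
      _ ≤ Real.exp (-δ * |(q : ℝ)|) * ((1 / ω + 2 * |(q : ℝ)|) * |(p : ℝ) + ω * q|) := by
        gcongr
        exact h4.trans (by gcongr)
      _ = _ := by ring
  by_cases h1 : ω ≤ |(p : ℝ) + ω * q|
  · left
    refine hnear (1 / ω) (by positivity) (by simpa using h1) (by linarith [abs_nonneg (q : ℝ)])
  by_cases h2 : 1 / (2 * (q : ℝ)) ≤ |(p : ℝ) + ω * q|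
  · left
    refine hnear (2 * q) (by positivity) h2 ?_
    rw [habs]
    linarith [one_div_pos.2 hω0]
  right
  obtain ⟨n, k, hk1, hk2, hqe, hpe⟩ := eq_mul_convergent_of_abs_lt hirr hω0 hω1 hq
    (p := -p) (by rw [ht]; exact not_le.1 h1) (by rw [ht]; exact not_le.1 h2)
  refine ⟨n, k, Finset.mem_Icc.2 ⟨hk1, hk2⟩, by rw [← hqe, ← hpe, neg_neg], ?_⟩
  have hk : (1 : ℝ) ≤ k := by exact_mod_cast hk1
  have hqr : (q : ℝ) = k * cfQ ω (n + 1) := by exact_mod_cast hqe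
  have hpr : (p : ℝ) = -(k * cfP ω (n + 1)) := by
    have : -(p : ℝ) = k * cfP ω (n + 1) := by exact_mod_cast hpe
    linarith
  have hD := abs_cfQ_mul_sub_cfP hirr hω0 hω1 (n + 1)
  have hx := cfX_spec hirr hω0 hω1 (n + 2)
  have hQ : (0 : ℝ) ≤ cfQ ω (n + 1) := Nat.cast_nonneg _
  have hval : |(p : ℝ) + ω * q| = k * |(cfQ ω (n + 1) : ℝ) * ω - cfP ω (n + 1)| := by
    rw [hpr, hqr, ← Nat.abs_cast k, ← abs_mul, Nat.abs_cast]
    congr 1; ring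
  have hDpos : 0 < |(cfQ ω (n + 1) : ℝ) * ω - cfP ω (n + 1)| := by
    rcases (abs_nonneg ((cfQ ω (n + 1) : ℝ) * ω - cfP ω (n + 1))).eq_or_lt with h | h
    · rw [← h] at hD; simp at hD
    · exact h
  have hD' : 1 ≤ |(cfQ ω (n + 1) : ℝ) * ω - cfP ω (n + 1)|
      * (cfQ ω (n + 1) + cfQ ω (n + 2)) := by
    rw [← hD]
    refine mul_le_mul_of_nonneg_left ?_ (abs_nonneg _)
    have : cfX ω (n + 2) * cfQ ω (n + 1) ≤ 1 * cfQ ω (n + 1) := by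
      gcongr; exact hx.2.2.le
    rw [show n + 1 + 1 = n + 2 from rfl]
    linarith
  have hexp2 : Real.exp (-δ * (|(p : ℝ)| + |(q : ℝ)|))
      ≤ Real.exp δ * Real.exp (-(k * cfQ ω (n + 1)) * ((1 + ω) * δ)) := by
    rw [← Real.exp_add]
    apply Real.exp_le_exp.2
    rw [← hqr, habs]
    have : ω * q - 1 ≤ |(p : ℝ)| := by
      have h3 := (abs_lt.1 hpq).2
      have h4 := neg_le_abs (p : ℝ)
      linarith
    nlinarith
  unfold divisorWeight convergentWeight
  have hk0 : (0 : ℝ) < k := by linarith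
  rw [hval, div_le_iff₀ (by positivity)]
  calc _ ≤ Real.exp δ * Real.exp (-(k * cfQ ω (n + 1)) * ((1 + ω) * δ)) * 1 := by
        simpa using hexp2
    _ ≤ Real.exp δ * Real.exp (-(k * cfQ ω (n + 1)) * ((1 + ω) * δ))
        * (|(cfQ ω (n + 1) : ℝ) * ω - cfP ω (n + 1)| * (cfQ ω (n + 1) + cfQ ω (n + 2))) := by
      gcongr
    _ = _ := by field_simp

lemma divisorWeight_le_of_ge {x : ℤ × ℤ} (hx : 1 / 2 ≤ |(x.1 : ℝ) + ω * x.2|) :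
    divisorWeight ω δ x ≤ 2 * (Real.exp (-δ * |(x.1 : ℝ)|) * Real.exp (-δ * |(x.2 : ℝ)|)) := by
  unfold divisorWeight
  rw [div_le_iff₀ (by linarith), ← Real.exp_add, ← mul_add]
  nlinarith [Real.exp_pos (-δ * (|(x.1 : ℝ)| + |(x.2 : ℝ)|))]

open Classical in
lemma ofReal_divisorWeight_le (hirr : Irrational ω) (hω0 : 0 < ω) (hω1 : ω < 1) (hδ : 0 < δ)
    (x : ℤ × ℤ) :
    ENNReal.ofReal (divisorWeight ω δ x) ≤
      ENNReal.ofReal (2 * (Real.exp (-δ * |(x.1 : ℝ)|) * Real.exp (-δ * |(x.2 : ℝ)|)))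
      + (if x.1 = round (-(ω * x.2)) then
          ENNReal.ofReal ((1 / ω + 2 * |(x.2 : ℝ)|) * Real.exp (-δ * |(x.2 : ℝ)|)) else 0)
      + ∑' n : ℕ, ∑ k ∈ Finset.Icc 1 (cfA ω (n + 2)),
        ((if x = (-(k * cfP ω (n + 1) : ℤ), (k * cfQ ω (n + 1) : ℤ)) then
            ENNReal.ofReal (convergentWeight ω δ n k) else 0)
          + (if x = -(-(k * cfP ω (n + 1) : ℤ), (k * cfQ ω (n + 1) : ℤ)) then
            ENNReal.ofReal (convergentWeight ω δ n k) else 0)) := by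
  obtain ⟨p, q⟩ := x
  by_cases h : 1 / 2 ≤ |(p : ℝ) + ω * q|
  · refine le_trans ?_ (le_self_add.trans le_self_add)
    exact ENNReal.ofReal_le_ofReal (divisorWeight_le_of_ge (x := (p, q)) h)
  push Not at h
  have hround : p = round (-(ω * q)) := by
    rw [round_eq]
    symm
    rw [Int.floor_eq_iff]
    have := abs_lt.1 h
    constructor <;> linarith
  simp only [if_pos hround]
  have hexc : ∀ n k : ℕ, k ∈ Finset.Icc 1 (cfA ω (n + 2)) → ∀ y : ℤ × ℤ,
      (y = (-(k * cfP ω (n + 1) : ℤ), (k * cfQ ω (n + 1) : ℤ)) ∨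
        y = -(-(k * cfP ω (n + 1) : ℤ), (k * cfQ ω (n + 1) : ℤ))) →
      ENNReal.ofReal (convergentWeight ω δ n k) ≤
      ∑' n : ℕ, ∑ k ∈ Finset.Icc 1 (cfA ω (n + 2)),
        ((if y = (-(k * cfP ω (n + 1) : ℤ), (k * cfQ ω (n + 1) : ℤ)) then
            ENNReal.ofReal (convergentWeight ω δ n k) else 0)
          + (if y = -(-(k * cfP ω (n + 1) : ℤ), (k * cfQ ω (n + 1) : ℤ)) then
            ENNReal.ofReal (convergentWeight ω δ n k) else 0)) := by
    intro n k hk y hy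
    refine le_trans ?_ (ENNReal.le_tsum n)
    refine le_trans ?_ (Finset.single_le_sum (fun _ _ => zero_le) hk)
    rcases hy with hy | hy
    · rw [if_pos hy]; exact le_self_add
    · rw [if_pos hy]; exact le_add_self
  rcases lt_trichotomy q 0 with hq | hq | hq
  · have h' : |((-p : ℤ) : ℝ) + ω * ((-q : ℤ) : ℝ)| < 1 / 2 := by
      have e : ((-p : ℤ) : ℝ) + ω * ((-q : ℤ) : ℝ) = -((p : ℝ) + ω * q) := by
        push_cast; ring
      rwa [e, abs_neg]
    have hw : divisorWeight ω δ (p, q) = divisorWeight ω δ (-p, -q) := by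
      rw [← divisorWeight_neg (p, q)]; rfl
    rw [hw]
    rcases divisorWeight_le_of_pos hirr hω0 hω1 hδ (by omega : 1 ≤ -q) h' with h1 | h1
    · refine le_trans ?_ (le_add_self.trans le_self_add)
      rw [Int.cast_neg, abs_neg] at h1
      exact ENNReal.ofReal_le_ofReal h1
    · obtain ⟨n, k, hk, he, hle⟩ := h1
      refine le_trans ?_ le_add_self
      refine (ENNReal.ofReal_le_ofReal hle).trans (hexc n k hk (p, q) (Or.inr ?_))
      rw [← he]; simp
  · subst hq
    have hp : p = 0 := by
      have h2 : |(p : ℝ)| < 1 := by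
        have : |(p : ℝ)| < 1 / 2 := by simpa using h
        linarith
      rw [← Int.abs_lt_one_iff]
      exact_mod_cast h2
    subst hp
    simp [divisorWeight]
  · rcases divisorWeight_le_of_pos hirr hω0 hω1 hδ (by omega : 1 ≤ q) h with h1 | h1
    · refine le_trans ?_ (le_add_self.trans le_self_add)
      exact ENNReal.ofReal_le_ofReal h1
    · obtain ⟨n, k, hk, he, hle⟩ := h1
      refine le_trans ?_ le_add_self
      exact (ENNReal.ofReal_le_ofReal hle).trans (hexc n k hk (p, q) (Or.inl he))

lemma sum_convergentWeight_le (hirr : Irrational ω) (hω0 : 0 < ω) (hω1 : ω < 1) (hδ : 0 < δ)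
    (n : ℕ) :
    ∑ k ∈ Finset.Icc 1 (cfA ω (n + 2)),
        (convergentWeight ω δ n k + convergentWeight ω δ n k) ≤
      4 * Real.exp δ * (Real.exp (-(cfQ ω (n + 1) : ℝ) * ((1 + ω) * δ)) * cfQ ω (n + 2))
      + 2 * Real.exp δ * (Real.exp (-(cfQ ω (n + 1) : ℝ) * (2 * ((1 + ω) * δ)))
        * cfQ ω (n + 2) * Real.log (cfA ω (n + 2))) := by
  set Δ := (1 + ω) * δ with hΔ
  have hΔ0 : 0 < Δ := by positivity
  set A := cfA ω (n + 2) with hA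
  set Q : ℝ := ((cfQ ω (n + 1) : ℕ) : ℝ) with hQ
  set Q' : ℝ := ((cfQ ω (n + 2) : ℕ) : ℝ) with hQ'
  have hA1 : 1 ≤ A := one_le_cfA hirr hω0 hω1 (n + 1)
  have hQ0 : 0 ≤ Q := Nat.cast_nonneg _
  have hQ'0 : 0 ≤ Q' := Nat.cast_nonneg _
  set E1 := Real.exp (-Q * Δ) with hE1
  set E2 := Real.exp (-Q * (2 * Δ)) with hE2
  have hE2pos : 0 < E2 := Real.exp_pos _
  have hE21 : E2 ≤ E1 := by
    apply Real.exp_le_exp.2; nlinarith [mul_nonneg hQ0 hΔ0.le]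
  have hAQ : (A : ℝ) * Q ≤ Q' := by
    rw [hQ, hQ', hA, ← Nat.cast_mul, Nat.cast_le]
    exact cfA_mul_cfQ_le (n + 1)
  have hlog : Real.log A + 1 ≤ A := by
    have := Real.log_le_sub_one_of_pos (by exact_mod_cast hA1 : (0 : ℝ) < A); linarith
  have hlog0 : 0 ≤ Real.log A := Real.log_natCast_nonneg _
  have hharm : ∑ k ∈ Finset.Ioc 1 A, (1 / (k : ℝ)) ≤ Real.log A := by
    have h1 := harmonic_le_one_add_log A
    rw [harmonic_eq_sum_Icc, Finset.Icc_eq_cons_Ioc hA1, Finset.sum_cons] at h1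
    push_cast at h1
    simp only [inv_one, add_le_add_iff_left] at h1
    simpa [one_div] using h1
  have hsum : ∑ k ∈ Finset.Icc 1 A, Real.exp (-(k * Q) * Δ) / k ≤ E1 + E2 * Real.log A := by
    rw [Finset.Icc_eq_cons_Ioc hA1, Finset.sum_cons]
    have h1 : Real.exp (-(((1 : ℕ) : ℝ) * Q) * Δ) / ((1 : ℕ) : ℝ) = E1 := by simp [hE1]
    rw [h1]
    gcongr
    calc ∑ k ∈ Finset.Ioc 1 A, Real.exp (-(k * Q) * Δ) / k
        ≤ ∑ k ∈ Finset.Ioc 1 A, E2 * (1 / (k : ℝ)) := by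
          refine Finset.sum_le_sum fun k hk => ?_
          have hk2 : (2 : ℝ) ≤ k := by exact_mod_cast (Finset.mem_Ioc.1 hk).1
          rw [mul_one_div]
          gcongr
          apply Real.exp_le_exp.2
          nlinarith [mul_nonneg hQ0 hΔ0.le]
      _ = E2 * ∑ k ∈ Finset.Ioc 1 A, (1 / (k : ℝ)) := by
          rw [← Finset.mul_sum]
      _ ≤ E2 * Real.log A := by gcongr
  have hrew : ∑ k ∈ Finset.Icc 1 A, (convergentWeight ω δ n k + convergentWeight ω δ n k)
      = 2 * Real.exp δ * (Q + Q') * ∑ k ∈ Finset.Icc 1 A, Real.exp (-(k * Q) * Δ) / k := by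
    rw [Finset.mul_sum]
    refine Finset.sum_congr rfl fun k _ => ?_
    unfold convergentWeight
    ring
  rw [hrew]
  calc _ ≤ 2 * Real.exp δ * (Q + Q') * (E1 + E2 * Real.log A) := by gcongr
    _ = 2 * Real.exp δ * (Q * E1 + Q' * E1 + Q * Real.log A * E2 + Q' * E2 * Real.log A) := by
      ring
    _ ≤ 2 * Real.exp δ * (Q * E1 + Q' * E1 + Q * Real.log A * E1 + Q' * E2 * Real.log A) := by
      gcongr
    _ = 2 * Real.exp δ * (Q * (Real.log A + 1) * E1 + Q' * E1 + Q' * E2 * Real.log A) := by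
      ring
    _ ≤ 2 * Real.exp δ * (Q' * E1 + Q' * E1 + Q' * E2 * Real.log A) := by
      gcongr
      nlinarith
    _ = _ := by ring

lemma tsum_linear_mul_exp_le (hω0 : 0 < ω) (hδ : 0 < δ) (hδ1 : δ ≤ 1) :
    ∑' q : ℤ, ENNReal.ofReal ((1 / ω + 2 * |(q : ℝ)|) * Real.exp (-δ * |(q : ℝ)|)) ≤
      ENNReal.ofReal ((8 / ω + 32) * δ⁻¹ ^ 2) := by
  have hpt : ∀ q : ℤ, (1 / ω + 2 * |(q : ℝ)|) * Real.exp (-δ * |(q : ℝ)|)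
      ≤ (1 / ω + 4 / δ) * Real.exp (-(δ / 2) * |(q : ℝ)|) := by
    intro q
    have h1 : Real.exp (-δ * |(q : ℝ)|)
        = Real.exp (-(δ / 2) * |(q : ℝ)|) * Real.exp (-(δ / 2) * |(q : ℝ)|) := by
      rw [← Real.exp_add]; congr 1; ring
    rw [h1, ← mul_assoc]
    gcongr
    have h2 : Real.exp (-(δ / 2) * |(q : ℝ)|) * Real.exp ((δ / 2) * |(q : ℝ)|) = 1 := by
      rw [← Real.exp_add]; simp
    have h3 := Real.add_one_le_exp ((δ / 2) * |(q : ℝ)|)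
    have h4 : Real.exp (-(δ / 2) * |(q : ℝ)|) ≤ 1 := by
      apply Real.exp_le_one_iff.2
      nlinarith [abs_nonneg (q : ℝ)]
    have h5 : |(q : ℝ)| * Real.exp (-(δ / 2) * |(q : ℝ)|) ≤ 2 / δ := by
      rw [le_div_iff₀ hδ]
      nlinarith [Real.exp_pos (-(δ / 2) * |(q : ℝ)|)]
    have h6 : 1 / ω * Real.exp (-(δ / 2) * |(q : ℝ)|) ≤ 1 / ω * 1 := by gcongr
    calc _ = 1 / ω * Real.exp (-(δ / 2) * |(q : ℝ)|)
          + 2 * (|(q : ℝ)| * Real.exp (-(δ / 2) * |(q : ℝ)|)) := by ring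
      _ ≤ 1 / ω * 1 + 2 * (2 / δ) := by gcongr
      _ = _ := by ring
  calc _ ≤ ∑' q : ℤ, ENNReal.ofReal (1 / ω + 4 / δ)
        * ENNReal.ofReal (Real.exp (-(δ / 2) * |(q : ℝ)|)) := by
        refine ENNReal.tsum_le_tsum fun q => ?_
        rw [← ENNReal.ofReal_mul (by positivity)]
        exact ENNReal.ofReal_le_ofReal (hpt q)
    _ ≤ ENNReal.ofReal (1 / ω + 4 / δ) * ENNReal.ofReal (4 / (δ / 2)) := by
        rw [ENNReal.tsum_mul_left]
        gcongr
        exact tsum_ofReal_exp_neg_mul_abs_le (by positivity) (by linarith)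
    _ = ENNReal.ofReal ((1 / ω + 4 / δ) * (4 / (δ / 2))) := by
        rw [← ENNReal.ofReal_mul (by positivity)]
    _ ≤ _ := by
        apply ENNReal.ofReal_le_ofReal
        have h1 : 1 / ω ≤ 1 / ω * δ⁻¹ :=
          le_mul_of_one_le_right (by positivity) ((one_le_inv₀ hδ).2 hδ1)
        calc (1 / ω + 4 / δ) * (4 / (δ / 2)) ≤ (1 / ω * δ⁻¹ + 4 / δ) * (4 / (δ / 2)) := by
              gcongr
          _ = _ := by field_simp; ring

lemma tsum_ofReal_divisorWeight_le (hirr : Irrational ω) (hω0 : 0 < ω) (hω1 : ω < 1)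
    (hδ : 0 < δ) (hδ1 : δ ≤ 1) :
    ∑' x : ℤ × ℤ, ENNReal.ofReal (divisorWeight ω δ x) ≤
      ENNReal.ofReal (4 * Real.exp δ) * Brj1 ω ((1 + ω) * δ)
      + ENNReal.ofReal (2 * Real.exp δ) * Brj2 ω (2 * ((1 + ω) * δ))
      + ENNReal.ofReal ((64 + 8 / ω) * δ⁻¹ ^ 2) := by
  classical
  refine (ENNReal.tsum_le_tsum (ofReal_divisorWeight_le hirr hω0 hω1 hδ)).trans ?_
  rw [ENNReal.tsum_add, ENNReal.tsum_add]
  have h1 : ∑' x : ℤ × ℤ,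
      ENNReal.ofReal (2 * (Real.exp (-δ * |(x.1 : ℝ)|) * Real.exp (-δ * |(x.2 : ℝ)|)))
      ≤ ENNReal.ofReal (32 * δ⁻¹ ^ 2) := by
    rw [ENNReal.tsum_prod']
    simp_rw [ENNReal.ofReal_mul (zero_le_two (α := ℝ)), ENNReal.ofReal_mul (Real.exp_pos _).le,
      ENNReal.tsum_mul_left, ENNReal.tsum_mul_right]
    have h := tsum_ofReal_exp_neg_mul_abs_le hδ hδ1
    calc _ ≤ ENNReal.ofReal 2 * (ENNReal.ofReal (4 / δ) * ENNReal.ofReal (4 / δ)) := by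
          gcongr
      _ = ENNReal.ofReal (2 * (4 / δ * (4 / δ))) := by
          rw [← ENNReal.ofReal_mul (by positivity), ← ENNReal.ofReal_mul (by positivity)]
      _ = _ := by congr 1; field_simp; ring
  have h2 : ∑' x : ℤ × ℤ, (if x.1 = round (-(ω * x.2)) then
        ENNReal.ofReal ((1 / ω + 2 * |(x.2 : ℝ)|) * Real.exp (-δ * |(x.2 : ℝ)|)) else 0)
      ≤ ENNReal.ofReal ((8 / ω + 32) * δ⁻¹ ^ 2) := by
    rw [ENNReal.tsum_prod', ENNReal.tsum_comm]
    refine le_trans (le_of_eq ?_) (tsum_linear_mul_exp_le hω0 hδ hδ1)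
    refine tsum_congr fun q => ?_
    exact tsum_ite_eq (round (-(ω * (q : ℝ)))) _
  have h3 : ∑' x : ℤ × ℤ, ∑' n : ℕ, ∑ k ∈ Finset.Icc 1 (cfA ω (n + 2)),
        ((if x = (-(k * cfP ω (n + 1) : ℤ), (k * cfQ ω (n + 1) : ℤ)) then
            ENNReal.ofReal (convergentWeight ω δ n k) else 0)
          + (if x = -(-(k * cfP ω (n + 1) : ℤ), (k * cfQ ω (n + 1) : ℤ)) then
            ENNReal.ofReal (convergentWeight ω δ n k) else 0))
      ≤ ENNReal.ofReal (4 * Real.exp δ) * Brj1 ω ((1 + ω) * δ)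
      + ENNReal.ofReal (2 * Real.exp δ) * Brj2 ω (2 * ((1 + ω) * δ)) := by
    rw [ENNReal.tsum_comm, Brj1, Brj2, ← ENNReal.tsum_mul_left, ← ENNReal.tsum_mul_left,
      ← ENNReal.tsum_add]
    refine ENNReal.tsum_le_tsum fun n => ?_
    rw [Summable.tsum_finsetSum fun _ _ => ENNReal.summable]
    have hw : ∀ k, 0 ≤ convergentWeight ω δ n k := fun k => by
      unfold convergentWeight; positivity
    simp_rw [ENNReal.tsum_add, tsum_ite_eq]
    simp_rw [← ENNReal.ofReal_add (hw _) (hw _)]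
    rw [← ENNReal.ofReal_sum_of_nonneg fun k _ => add_nonneg (hw k) (hw k),
      ← ENNReal.ofReal_mul (by positivity), ← ENNReal.ofReal_mul (by positivity),
      ← ENNReal.ofReal_add (by positivity)
        (mul_nonneg (by positivity) (mul_nonneg (by positivity) (Real.log_natCast_nonneg _)))]
    exact ENNReal.ofReal_le_ofReal (sum_convergentWeight_le hirr hω0 hω1 hδ n)
  calc _ ≤ ENNReal.ofReal (32 * δ⁻¹ ^ 2) + ENNReal.ofReal ((8 / ω + 32) * δ⁻¹ ^ 2)
        + (ENNReal.ofReal (4 * Real.exp δ) * Brj1 ω ((1 + ω) * δ)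
          + ENNReal.ofReal (2 * Real.exp δ) * Brj2 ω (2 * ((1 + ω) * δ))) := by gcongr
    _ = _ := by
        rw [← ENNReal.ofReal_add (by positivity) (by positivity), add_comm]
        congr 2
        ring

/-- The small divisor series is summable and bounded by the Brjuno-like functions. -/
lemma summable_divisorWeight_and_tsum_le (hirr : Irrational ω) (hω0 : 0 < ω) (hω1 : ω < 1)
    (hδ : 0 < δ) (hδ1 : δ ≤ 1) (hB1 : Brj1 ω ((1 + ω) * δ) ≠ ⊤)
    (hB2 : Brj2 ω (2 * ((1 + ω) * δ)) ≠ ⊤) :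
    Summable (divisorWeight ω δ) ∧ ∑' x, divisorWeight ω δ x ≤
      4 * Real.exp δ * (Brj1 ω ((1 + ω) * δ)).toReal
      + 2 * Real.exp δ * (Brj2 ω (2 * ((1 + ω) * δ))).toReal
      + (64 + 8 / ω) * δ⁻¹ ^ 2 := by
  have h := tsum_ofReal_divisorWeight_le hirr hω0 hω1 hδ hδ1
  rw [← ENNReal.ofReal_toReal hB1, ← ENNReal.ofReal_toReal hB2,
    ← ENNReal.ofReal_mul (by positivity), ← ENNReal.ofReal_mul (by positivity),
    ← ENNReal.ofReal_add (by positivity) (by positivity),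
    ← ENNReal.ofReal_add (by positivity) (by positivity)] at h
  have hs : Summable (divisorWeight ω δ) := by
    have h1 := ENNReal.summable_toReal (ne_top_of_le_ne_top ENNReal.ofReal_ne_top h)
    simpa [ENNReal.toReal_ofReal, divisorWeight_nonneg] using h1
  refine ⟨hs, ?_⟩
  rw [← ENNReal.ofReal_tsum_of_nonneg divisorWeight_nonneg hs] at h
  exact (ENNReal.ofReal_le_ofReal_iff (by positivity)).1 h

end SmallDivisors

section Fourier

lemma hasSum_fourier_of_periodic {F : ℝ → ℂ} (hF : Continuous F)
    (hper : Function.Periodic F (2 * Real.pi))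
    (hs : Summable fun q : ℤ => (1 / (2 * Real.pi) : ℂ) *
      ∫ t in (0 : ℝ)..(2 * Real.pi), F t * Complex.exp (-Complex.I * (q * t))) (t : ℝ) :
    HasSum (fun q : ℤ => (1 / (2 * Real.pi) : ℂ) *
      (∫ t in (0 : ℝ)..(2 * Real.pi), F t * Complex.exp (-Complex.I * (q * t)))
        * Complex.exp (Complex.I * (q * t))) (F t) := by
  have : Fact (0 < 2 * Real.pi) := ⟨Real.two_pi_pos⟩
  have hpi : (Real.pi : ℂ) ≠ 0 := by exact_mod_cast Real.pi_ne_zero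
  let f : C(AddCircle (2 * Real.pi), ℂ) :=
    ⟨hper.lift, (QuotientAddGroup.isQuotientMap_mk _).continuous_iff.2 hF⟩
  have hf : ∀ s : ℝ, f (s : AddCircle (2 * Real.pi)) = F s := fun s => rfl
  have hc : ∀ q : ℤ, fourierCoeff f q = (1 / (2 * Real.pi) : ℂ) *
      ∫ t in (0 : ℝ)..(2 * Real.pi), F t * Complex.exp (-Complex.I * (q * t)) := by
    intro q
    rw [fourierCoeff_eq_intervalIntegral f q 0, zero_add, Complex.real_smul]
    congr 1
    · push_cast; rfl
    · refine intervalIntegral.integral_congr fun s _ => ?_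
      simp only [hf, fourier_coe_apply, smul_eq_mul]
      rw [mul_comm]
      congr 2
      push_cast
      field_simp
  have h := has_pointwise_sum_fourier_series_of_summable (f := f)
    (by rw [funext hc]; exact hs) (t : AddCircle (2 * Real.pi))
  rw [hf] at h
  refine (congrArg (HasSum · _) (funext fun q => ?_)).mpr h
  rw [hc, fourier_coe_apply, smul_eq_mul]
  congr 2
  push_cast
  field_simp

/-- Fourier coefficients of a function on the two-dimensional torus. -/
noncomputable def torusCoeff (F : ℝ → ℝ → ℂ) (x : ℤ × ℤ) : ℂ :=
  (1 / (2 * Real.pi) : ℂ) * ∫ t in (0 : ℝ)..(2 * Real.pi), ((1 / (2 * Real.pi) : ℂ) *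
    ∫ s in (0 : ℝ)..(2 * Real.pi), F s t * Complex.exp (-Complex.I * (x.1 * s)))
      * Complex.exp (-Complex.I * (x.2 * t))

/-- The exponential `(z₁, z₂) ↦ exp (i (p z₁ + q z₂))`. -/
noncomputable def torusExp (x : ℤ × ℤ) (z : ℂ × ℂ) : ℂ :=
  Complex.exp (Complex.I * (x.1 * z.1 + x.2 * z.2))

lemma torusExp_eq_mul (x : ℤ × ℤ) (z : ℂ × ℂ) :
    torusExp x z = Complex.exp (Complex.I * (x.1 * z.1)) * Complex.exp (Complex.I * (x.2 * z.2)) := by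
  rw [torusExp, mul_add, Complex.exp_add]

lemma torusExp_neg (x : ℤ × ℤ) (z : ℂ × ℂ) :
    torusExp (-x) z = Complex.exp (-Complex.I * (x.1 * z.1))
      * Complex.exp (-Complex.I * (x.2 * z.2)) := by
  rw [torusExp, ← Complex.exp_add]
  congr 1
  push_cast [Prod.fst_neg, Prod.snd_neg]
  ring

lemma norm_torusExp (x : ℤ × ℤ) (z : ℂ × ℂ) :
    ‖torusExp x z‖ = Real.exp (-(x.1 * z.1.im + x.2 * z.2.im)) := by
  rw [torusExp, Complex.norm_exp]
  simp

lemma norm_torusExp_le {σ : ℝ} (x : ℤ × ℤ) {z : ℂ × ℂ}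
    (hz : z ∈ closedStrip σ ×ˢ closedStrip σ) :
    ‖torusExp x z‖ ≤ Real.exp (σ * (|(x.1 : ℝ)| + |(x.2 : ℝ)|)) := by
  rw [norm_torusExp]
  apply Real.exp_le_exp.2
  have h1 : |z.1.im| ≤ σ := hz.1
  have h2 : |z.2.im| ≤ σ := hz.2
  have h3 : -((x.1 : ℝ) * z.1.im) ≤ |(x.1 : ℝ)| * σ := by
    refine (neg_le_abs _).trans ?_
    rw [abs_mul]
    gcongr
  have h4 : -((x.2 : ℝ) * z.2.im) ≤ |(x.2 : ℝ)| * σ := by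
    refine (neg_le_abs _).trans ?_
    rw [abs_mul]
    gcongr
  linarith

@[fun_prop]
lemma continuous_torusExp (x : ℤ × ℤ) : Continuous (torusExp x) := by
  unfold torusExp; fun_prop

lemma hasSum_torusCoeff {F : ℝ → ℝ → ℂ} (hF : Continuous (Function.uncurry F))
    (hper1 : ∀ t, Function.Periodic (fun s => F s t) (2 * Real.pi))
    (hper2 : ∀ s, Function.Periodic (fun t => F s t) (2 * Real.pi))
    (hs : Summable (torusCoeff F)) (s t : ℝ) :
    HasSum (fun x => torusCoeff F x * torusExp x (s, t)) (F s t) := by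
  set B : ℤ → ℝ → ℂ := fun p t => (1 / (2 * Real.pi) : ℂ) *
    ∫ s in (0 : ℝ)..(2 * Real.pi), F s t * Complex.exp (-Complex.I * (p * s)) with hB
  have hBcont : ∀ p, Continuous (B p) := by
    intro p
    refine continuous_const.mul ?_
    refine intervalIntegral.continuous_parametric_intervalIntegral_of_continuous' ?_ _ _
    have : Continuous fun w : ℝ × ℝ => F w.2 w.1 := hF.comp continuous_swap
    exact this.mul (by fun_prop)
  have hBper : ∀ p, Function.Periodic (B p) (2 * Real.pi) := by
    intro p t
    simp only [hB]
    congr 1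
    refine intervalIntegral.integral_congr fun s _ => ?_
    simp only [(hper2 s) t]
  have hsn := hs.norm
  have hrow : ∀ p, HasSum (fun q : ℤ => torusCoeff F (p, q) * Complex.exp (Complex.I * (q * t)))
      (B p t) := fun p => hasSum_fourier_of_periodic (hBcont p) (hBper p)
        (Summable.of_norm (hsn.prod_factor p)) t
  have hexp : ∀ (q : ℤ) (t : ℝ), ‖Complex.exp (Complex.I * (q * t))‖ = 1 := by
    intro q t
    rw [Complex.norm_exp]
    simp
  have hBnorm : ∀ p, ‖B p t‖ ≤ ∑' q, ‖torusCoeff F (p, q)‖ := by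
    intro p
    rw [← (hrow p).tsum_eq]
    refine (norm_tsum_le_tsum_norm ?_).trans (le_of_eq ?_)
    · simpa only [norm_mul, hexp, mul_one] using hsn.prod_factor p
    · simp only [norm_mul, hexp, mul_one]
  have hBs : Summable fun p => B p t := Summable.of_norm_bounded hsn.prod hBnorm
  have hcol : HasSum (fun p : ℤ => B p t * Complex.exp (Complex.I * (p * s))) (F s t) :=
    hasSum_fourier_of_periodic (F := fun s => F s t)
      (hF.comp (Continuous.prodMk_left t)) (hper1 t) hBs s
  have htot : Summable fun x => torusCoeff F x * torusExp x (s, t) := by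
    refine Summable.of_norm ?_
    simpa only [torusExp_eq_mul, norm_mul, hexp, mul_one] using hsn
  have hfib : HasSum (fun p : ℤ => B p t * Complex.exp (Complex.I * (p * s)))
      (∑' x, torusCoeff F x * torusExp x (s, t)) := by
    refine htot.hasSum.prod_fiberwise fun p => ?_
    refine (congrArg (HasSum · _) (funext fun q => ?_)).mpr ((hrow p).mul_right (Complex.exp (Complex.I * (p * s))))
    rw [torusExp_eq_mul]
    ring
  rw [← hfib.unique hcol]
  exact htot.hasSum

lemma torusCoeff_eq (F : ℝ → ℝ → ℂ) (x : ℤ × ℤ) :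
    torusCoeff F x = (1 / (2 * Real.pi) : ℂ) ^ 2 * ∫ t in (0 : ℝ)..(2 * Real.pi),
      ∫ s in (0 : ℝ)..(2 * Real.pi), F s t * torusExp (-x) (s, t) := by
  simp only [torusCoeff, torusExp_neg, sq, ← mul_assoc, intervalIntegral.integral_mul_const]
  simp only [mul_assoc, intervalIntegral.integral_const_mul]

lemma norm_torusCoeff_le {F : ℝ → ℝ → ℂ} {M : ℝ} (hM : ∀ s t, ‖F s t‖ ≤ M) (x : ℤ × ℤ) :
    ‖torusCoeff F x‖ ≤ M := by
  have hpi := Real.two_pi_pos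
  have h1 : ∀ t : ℝ, ‖∫ s in (0 : ℝ)..(2 * Real.pi), F s t * torusExp (-x) (s, t)‖
      ≤ M * |2 * Real.pi - 0| := fun t =>
    intervalIntegral.norm_integral_le_of_norm_le_const fun s _ => by
      rw [norm_mul, norm_torusExp]
      simpa using hM s t
  have h2 := intervalIntegral.norm_integral_le_of_norm_le_const
    (a := 0) (b := 2 * Real.pi) fun t _ => h1 t
  rw [torusCoeff_eq, norm_mul]
  have h3 : ‖(1 / (2 * Real.pi) : ℂ) ^ 2‖ = 1 / (2 * Real.pi) ^ 2 := by
    rw [norm_pow, norm_div, norm_mul]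
    simp [abs_of_pos Real.pi_pos]
    ring
  rw [h3]
  rw [sub_zero, abs_of_pos hpi] at h2
  calc _ ≤ 1 / (2 * Real.pi) ^ 2 * (M * (2 * Real.pi) * (2 * Real.pi)) := by gcongr
    _ = M := by field_simp

lemma integral_integral_swap_of_continuous {f : ℝ → ℝ → ℂ}
    (hf : Continuous (Function.uncurry f)) (a b c d : ℝ) :
    ∫ t in a..b, ∫ s in c..d, f t s = ∫ s in c..d, ∫ t in a..b, f t s := by
  refine MeasureTheory.intervalIntegral_intervalIntegral_swap ?_
  refine MeasureTheory.IntegrableOn.mono_set (t := Set.uIcc a b ×ˢ Set.uIcc c d)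
    (hf.continuousOn.integrableOn_compact (isCompact_uIcc.prod isCompact_uIcc)) ?_
  exact Set.prod_mono Set.uIoc_subset_uIcc Set.uIoc_subset_uIcc

lemma isOpen_openStrip (r : ℝ) : IsOpen (openStrip r) :=
  isOpen_lt (Complex.continuous_im.abs) continuous_const

lemma convex_openStrip (r : ℝ) : Convex ℝ (openStrip r) := by
  have : openStrip r = Complex.imCLM ⁻¹' Set.Ioo (-r) r := by
    ext z
    simp [openStrip, abs_lt]
  rw [this]
  exact (convex_Ioo _ _).is_linear_preimage Complex.imCLM.toLinearMap.isLinear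

lemma openStrip_subset_closedStrip (r : ℝ) : openStrip r ⊆ closedStrip r :=
  fun z (hz : |z.im| < r) => (show |z.im| ≤ r from hz.le)

/-- Integrals over horizontal periods of a periodic holomorphic function do not depend on the
height. -/
lemma integral_add_mul_I_eq {r : ℝ} {f : ℂ → ℂ} (hf : DifferentiableOn ℂ f (openStrip r))
    (hper : ∀ z, f (z + 2 * Real.pi) = f z) {η : ℝ} (hη : |η| < r) :
    ∫ s in (0 : ℝ)..(2 * Real.pi), f (s + η * Complex.I) = ∫ s in (0 : ℝ)..(2 * Real.pi), f s := by
  have hr : 0 < r := (abs_nonneg η).trans_lt hη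
  have h := Complex.integral_boundary_rect_eq_zero_of_differentiableOn f 0
    (⟨2 * Real.pi, η⟩ : ℂ) (hf.mono ?_)
  · simp only [Complex.zero_re, Complex.zero_im, Complex.ofReal_zero, zero_mul, add_zero,
      zero_add] at h
    have h2 : ∀ y : ℝ, f (((2 * Real.pi : ℝ) : ℂ) + y * Complex.I) = f (y * Complex.I) := by
      intro y
      rw [← hper (y * Complex.I)]
      congr 1
      push_cast
      ring
    simp only [h2] at h
    rw [add_sub_cancel_right, sub_eq_zero] at h
    exact h.symm
  · rintro z ⟨-, hz⟩
    have hz' : z.im ∈ Set.uIcc 0 η := hz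
    have : |z.im| ≤ |η| := by simpa using Set.abs_sub_left_of_mem_uIcc hz'
    exact this.trans_lt hη

variable {ρ : ℝ} {a : ℂ × ℂ → ℂ}

lemma MemP0.continuous_shift (ha : MemP0 ρ a) {η ξ : ℝ} (hη : |η| < ρ) (hξ : |ξ| < ρ) :
    Continuous (Function.uncurry fun s t : ℝ => a (s + η * Complex.I, t + ξ * Complex.I)) := by
  refine ha.contOn.comp_continuous (f := fun w : ℝ × ℝ =>
    ((w.1 : ℂ) + η * Complex.I, (w.2 : ℂ) + ξ * Complex.I)) (by fun_prop) fun w => ?_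
  constructor <;> simp [closedStrip, hη.le, hξ.le]

lemma MemP0.integral_shift (ha : MemP0 ρ a) (x : ℤ × ℤ) {η ξ : ℝ} (hη : |η| < ρ)
    (hξ : |ξ| < ρ) :
    ∫ t in (0 : ℝ)..(2 * Real.pi), ∫ s in (0 : ℝ)..(2 * Real.pi),
      a (s + η * Complex.I, t + ξ * Complex.I)
        * torusExp x (s + η * Complex.I, t + ξ * Complex.I)
    = ∫ t in (0 : ℝ)..(2 * Real.pi), ∫ s in (0 : ℝ)..(2 * Real.pi),
      a (s, t) * torusExp x (s, t) := by
  have hρ : 0 < ρ := (abs_nonneg η).trans_lt hη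
  have hdiff : DifferentiableOn ℂ (fun z => a z * torusExp x z)
      (openStrip ρ ×ˢ openStrip ρ) :=
    ha.diffOn.mul (by unfold torusExp; fun_prop)
  have hexp : ∀ (n : ℤ) (w : ℂ), Complex.exp (Complex.I * (n * (w + 2 * Real.pi)))
      = Complex.exp (Complex.I * (n * w)) := by
    intro n w
    have e : Complex.I * (n * (w + 2 * Real.pi))
        = Complex.I * (n * w) + n * (2 * Real.pi * Complex.I) := by ring
    rw [e]
    exact Complex.exp_periodic.int_mul n _
  have hreal : ∀ s : ℝ, (s : ℂ) ∈ openStrip ρ := fun s => by simpa [openStrip] using hρ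
  have hshift : ∀ (s c : ℝ), |c| < ρ → (s : ℂ) + c * Complex.I ∈ openStrip ρ := fun s c hc => by
    simpa [openStrip] using hc
  have h1 : ∀ w ∈ openStrip ρ, ∫ s in (0 : ℝ)..(2 * Real.pi),
      a (s + η * Complex.I, w) * torusExp x (s + η * Complex.I, w)
      = ∫ s in (0 : ℝ)..(2 * Real.pi), a (s, w) * torusExp x (s, w) := by
    intro w hw
    refine integral_add_mul_I_eq (r := ρ) (f := fun z => a (z, w) * torusExp x (z, w)) ?_ ?_ hη
    · exact hdiff.comp (f := fun z => (z, w)) (by fun_prop) fun z hz => ⟨hz, hw⟩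
    · intro z
      rw [ha.periodic_fst (z, w), torusExp_eq_mul, torusExp_eq_mul]
      simp only [hexp]
  have h2 : ∀ v ∈ openStrip ρ, ∫ t in (0 : ℝ)..(2 * Real.pi),
      a (v, t + ξ * Complex.I) * torusExp x (v, t + ξ * Complex.I)
      = ∫ t in (0 : ℝ)..(2 * Real.pi), a (v, t) * torusExp x (v, t) := by
    intro v hv
    refine integral_add_mul_I_eq (r := ρ) (f := fun z => a (v, z) * torusExp x (v, z)) ?_ ?_ hξ
    · exact hdiff.comp (f := fun z => (v, z)) (by fun_prop) fun z hz => ⟨hv, hz⟩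
    · intro z
      rw [ha.periodic_snd (v, z), torusExp_eq_mul, torusExp_eq_mul]
      simp only [hexp]
  have hswap : ∀ c : ℝ, |c| < ρ → ∫ t in (0 : ℝ)..(2 * Real.pi), ∫ s in (0 : ℝ)..(2 * Real.pi),
        a (s, t + c * Complex.I) * torusExp x (s, t + c * Complex.I)
      = ∫ s in (0 : ℝ)..(2 * Real.pi), ∫ t in (0 : ℝ)..(2 * Real.pi),
        a (s, t + c * Complex.I) * torusExp x (s, t + c * Complex.I) := by
    intro c hc
    have h0 : |(0 : ℝ)| < ρ := by simpa using hρ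
    have hc' : Continuous (Function.uncurry fun t s : ℝ =>
        a (s, t + c * Complex.I) * torusExp x (s, t + c * Complex.I)) := by
      have h3 := (ha.continuous_shift h0 hc).comp continuous_swap
      simp only [Complex.ofReal_zero, zero_mul, add_zero] at h3
      refine h3.mul ?_
      exact (continuous_torusExp x).comp (f := fun w : ℝ × ℝ =>
        ((w.2 : ℂ), (w.1 : ℂ) + c * Complex.I)) (by fun_prop)
    exact integral_integral_swap_of_continuous hc' _ _ _ _
  calc _ = ∫ t in (0 : ℝ)..(2 * Real.pi), ∫ s in (0 : ℝ)..(2 * Real.pi),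
        a (s, t + ξ * Complex.I) * torusExp x (s, t + ξ * Complex.I) :=
        intervalIntegral.integral_congr fun t _ => h1 _ (hshift t ξ hξ)
    _ = ∫ s in (0 : ℝ)..(2 * Real.pi), ∫ t in (0 : ℝ)..(2 * Real.pi),
        a (s, t + ξ * Complex.I) * torusExp x (s, t + ξ * Complex.I) := hswap ξ hξ
    _ = ∫ s in (0 : ℝ)..(2 * Real.pi), ∫ t in (0 : ℝ)..(2 * Real.pi),
        a (s, t) * torusExp x (s, t) :=
        intervalIntegral.integral_congr fun s _ => h2 _ (hreal s)
    _ = _ := by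
        have := hswap 0 (by simpa using hρ)
        simp only [Complex.ofReal_zero, zero_mul, add_zero] at this
        exact this.symm

lemma MemP0.torusCoeff_shift (ha : MemP0 ρ a) (x : ℤ × ℤ) {η ξ : ℝ} (hη : |η| < ρ)
    (hξ : |ξ| < ρ) :
    torusCoeff (fun s t => a (s + η * Complex.I, t + ξ * Complex.I)) x
      = torusExp x (η * Complex.I, ξ * Complex.I) * torusCoeff (fun s t => a (s, t)) x := by
  rw [torusCoeff_eq, torusCoeff_eq, ← ha.integral_shift (-x) hη hξ, mul_left_comm]
  congr 1
  rw [← intervalIntegral.integral_const_mul]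
  refine intervalIntegral.integral_congr fun t _ => ?_
  rw [← intervalIntegral.integral_const_mul]
  refine intervalIntegral.integral_congr fun s _ => ?_
  rw [mul_left_comm]
  congr 1
  simp only [torusExp, ← Complex.exp_add, Prod.fst_neg, Prod.snd_neg, Int.cast_neg]
  congr 1
  ring

lemma MemP0.norm_torusCoeff_le (ha : MemP0 ρ a) (hρ : 0 < ρ) {M : ℝ}
    (hM : ∀ z ∈ closedStrip ρ ×ˢ closedStrip ρ, ‖a z‖ ≤ M) (x : ℤ × ℤ) :
    ‖torusCoeff (fun s t => a (s, t)) x‖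
      ≤ M * Real.exp (-ρ * (|(x.1 : ℝ)| + |(x.2 : ℝ)|)) := by
  have hsign : ∀ n : ℤ, ∃ ε : ℝ, |ε| ≤ 1 ∧ (n : ℝ) * ε = -|(n : ℝ)| := by
    intro n
    rcases le_total 0 (n : ℝ) with h | h
    · exact ⟨-1, by simp, by rw [abs_of_nonneg h]; ring⟩
    · exact ⟨1, by simp, by rw [abs_of_nonpos h]; ring⟩
  obtain ⟨ε₁, h1, h1'⟩ := hsign x.1
  obtain ⟨ε₂, h2, h2'⟩ := hsign x.2
  have hlt : ∀ r ∈ Set.Ioo 0 ρ, ‖torusCoeff (fun s t => a (s, t)) x‖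
      ≤ M * Real.exp (-r * (|(x.1 : ℝ)| + |(x.2 : ℝ)|)) := by
    rintro r ⟨hr0, hr⟩
    have hb : ∀ ε : ℝ, |ε| ≤ 1 → |r * ε| < ρ := by
      intro ε hε
      rw [abs_mul, abs_of_pos hr0]
      nlinarith
    have hs := ha.torusCoeff_shift x (hb ε₁ h1) (hb ε₂ h2)
    have hle := _root_.norm_torusCoeff_le (M := M)
      (F := fun s t => a (s + ((r * ε₁ : ℝ) : ℂ) * Complex.I, t + ((r * ε₂ : ℝ) : ℂ) * Complex.I))
      (fun s t => hM _ ⟨by simpa [closedStrip, -Complex.ofReal_mul] using (hb ε₁ h1).le,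
        by simpa [closedStrip, -Complex.ofReal_mul] using (hb ε₂ h2).le⟩) x
    rw [hs, norm_mul, norm_torusExp] at hle
    have e : -((x.1 : ℝ) * (((r * ε₁ : ℝ) : ℂ) * Complex.I).im
        + x.2 * (((r * ε₂ : ℝ) : ℂ) * Complex.I).im) = r * (|(x.1 : ℝ)| + |(x.2 : ℝ)|) := by
      rw [Complex.im_ofReal_mul, Complex.im_ofReal_mul, Complex.I_im]
      linear_combination (-r) * h1' - r * h2'
    rw [e] at hle
    have h3 : Real.exp (r * (|(x.1 : ℝ)| + |(x.2 : ℝ)|))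
        * Real.exp (-r * (|(x.1 : ℝ)| + |(x.2 : ℝ)|)) = 1 := by
      rw [← Real.exp_add]; simp
    calc _ = Real.exp (r * (|(x.1 : ℝ)| + |(x.2 : ℝ)|)) * ‖torusCoeff (fun s t => a (s, t)) x‖
          * Real.exp (-r * (|(x.1 : ℝ)| + |(x.2 : ℝ)|)) := by
          rw [mul_right_comm, h3, one_mul]
      _ ≤ _ := by gcongr
  have hcont : Continuous fun r : ℝ => M * Real.exp (-r * (|(x.1 : ℝ)| + |(x.2 : ℝ)|)) := by
    fun_prop
  refine ge_of_tendsto (hcont.continuousWithinAt (s := Set.Iio ρ) (x := ρ)) ?_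
  filter_upwards [Ioo_mem_nhdsLT hρ] with r hr using hlt r hr

lemma MemP0.norm_le_supNorm (ha : MemP0 ρ a) {z : ℂ × ℂ}
    (hz : z ∈ closedStrip ρ ×ˢ closedStrip ρ) : ‖a z‖ ≤ supNorm ρ a := by
  have hK : IsCompact ((Set.Icc 0 (2 * Real.pi) ×ℂ Set.Icc (-ρ) ρ) ×ˢ
      (Set.Icc 0 (2 * Real.pi) ×ℂ Set.Icc (-ρ) ρ)) :=
    (isCompact_Icc.reProdIm isCompact_Icc).prod (isCompact_Icc.reProdIm isCompact_Icc)
  have hsub : ((Set.Icc 0 (2 * Real.pi) ×ℂ Set.Icc (-ρ) ρ) ×ˢ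
      (Set.Icc 0 (2 * Real.pi) ×ℂ Set.Icc (-ρ) ρ)) ⊆ closedStrip ρ ×ˢ closedStrip ρ :=
    fun w hw => ⟨abs_le.2 hw.1.2, abs_le.2 hw.2.2⟩
  obtain ⟨C, hC⟩ := hK.exists_bound_of_continuousOn (ha.contOn.mono hsub)
  have hred : ∀ w ∈ closedStrip ρ, ∃ n : ℤ,
      w - n * (2 * Real.pi) ∈ Set.Icc 0 (2 * Real.pi) ×ℂ Set.Icc (-ρ) ρ := by
    intro w hw
    have hpi := Real.two_pi_pos
    refine ⟨⌊w.re / (2 * Real.pi)⌋, ?_⟩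
    have hre : (w - (⌊w.re / (2 * Real.pi)⌋ : ℤ) * (2 * Real.pi)).re
        = w.re - ⌊w.re / (2 * Real.pi)⌋ * (2 * Real.pi) := by simp
    have him : (w - (⌊w.re / (2 * Real.pi)⌋ : ℤ) * (2 * Real.pi)).im = w.im := by simp
    rw [Complex.mem_reProdIm, hre, him]
    have h1 := Int.floor_le (w.re / (2 * Real.pi))
    have h2 := (Int.lt_floor_add_one (w.re / (2 * Real.pi))).le
    rw [le_div_iff₀ hpi] at h1
    rw [div_le_iff₀ hpi] at h2
    exact ⟨⟨by linarith, by linarith⟩, abs_le.1 hw⟩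
  have hbdd : BddAbove (Set.range fun w : (closedStrip ρ ×ˢ closedStrip ρ : Set (ℂ × ℂ)) =>
      ‖a w‖) := by
    refine ⟨C, ?_⟩
    rintro _ ⟨⟨⟨w₁, w₂⟩, hw₁, hw₂⟩, rfl⟩
    obtain ⟨n₁, hn₁⟩ := hred w₁ hw₁
    obtain ⟨n₂, hn₂⟩ := hred w₂ hw₂
    have hp1 : Function.Periodic (fun v => a (v, w₂)) (2 * Real.pi) :=
      fun v => ha.periodic_fst (v, w₂)
    have hp2 : Function.Periodic (fun v => a (w₁ - n₁ * (2 * Real.pi), v)) (2 * Real.pi) :=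
      fun v => ha.periodic_snd (w₁ - n₁ * (2 * Real.pi), v)
    have h1 := hp1.sub_int_mul_eq (x := w₁) n₁
    have h2 := hp2.sub_int_mul_eq (x := w₂) n₂
    simp only at h1 h2 ⊢
    rw [← h1, ← h2]
    exact hC _ ⟨hn₁, hn₂⟩
  exact le_ciSup hbdd ⟨z, hz⟩

/-- Fourier expansion of an element of `𝒫₀(ρ)` on the open bi-strip. -/
lemma MemP0.hasSum (ha : MemP0 ρ a) {z : ℂ × ℂ} (hz : z ∈ openStrip ρ ×ˢ openStrip ρ) :
    HasSum (fun x => torusCoeff (fun s t => a (s, t)) x * torusExp x z) (a z) := by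
  obtain ⟨⟨s, η⟩, ⟨t, ξ⟩⟩ := z
  have hη : |η| < ρ := hz.1
  have hξ : |ξ| < ρ := hz.2
  have hρ : 0 < ρ := (abs_nonneg η).trans_lt hη
  set m := max |η| |ξ| with hm
  have hmρ : 0 < ρ - m := sub_pos.2 (max_lt hη hξ)
  have hsum : Summable (torusCoeff fun s t => a (s + η * Complex.I, t + ξ * Complex.I)) := by
    have hgeom := summable_exp_neg_mul_abs hmρ
    refine Summable.of_norm_bounded (g := fun x : ℤ × ℤ => supNorm ρ a *
      (Real.exp (-(ρ - m) * |(x.1 : ℝ)|) * Real.exp (-(ρ - m) * |(x.2 : ℝ)|))) ?_ ?_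
    · exact (Summable.mul_of_nonneg hgeom hgeom
        (fun _ => (Real.exp_pos _).le) (fun _ => (Real.exp_pos _).le)).mul_left _
    · intro x
      rw [ha.torusCoeff_shift x hη hξ, norm_mul]
      have h1 := norm_torusExp_le (σ := m) x
        (z := ((η : ℂ) * Complex.I, (ξ : ℂ) * Complex.I))
        ⟨by simp [closedStrip, hm], by simp [closedStrip, hm]⟩
      have h2 := ha.norm_torusCoeff_le hρ (fun z hz => ha.norm_le_supNorm hz) x
      calc _ ≤ Real.exp (m * (|(x.1 : ℝ)| + |(x.2 : ℝ)|)) *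
            (supNorm ρ a * Real.exp (-ρ * (|(x.1 : ℝ)| + |(x.2 : ℝ)|))) := by gcongr
        _ = _ := by
          rw [mul_left_comm, ← Real.exp_add, ← Real.exp_add]
          congr 2
          ring
  have h := hasSum_torusCoeff (ha.continuous_shift hη hξ)
    (fun t' s' => by
      simpa [add_right_comm] using
        ha.periodic_fst (s' + η * Complex.I, t' + ξ * Complex.I))
    (fun s' t' => by
      simpa [add_right_comm] using
        ha.periodic_snd (s' + η * Complex.I, t' + ξ * Complex.I)) hsum s t
  have hz' : ∀ u v : ℝ, (⟨u, v⟩ : ℂ) = u + v * Complex.I := fun u v => Complex.mk_eq_add_mul_I u v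
  simp only [hz']
  refine (congrArg (HasSum · _) (funext fun x => ?_)).mpr h
  rw [ha.torusCoeff_shift x hη hξ, mul_right_comm, mul_comm]
  congr 1
  simp only [torusExp, ← Complex.exp_add]
  congr 1
  ring

end Fourier

section Series

/-- The trigonometric series with coefficients `u`. -/
noncomputable def torusSeries (u : ℤ × ℤ → ℂ) (z : ℂ × ℂ) : ℂ := ∑' x, u x * torusExp x z

lemma hasFDerivAt_torusExp (x : ℤ × ℤ) (z : ℂ × ℂ) :
    HasFDerivAt (torusExp x) (torusExp x z • (Complex.I • ((x.1 : ℂ) • ContinuousLinearMap.fst ℂ ℂ ℂ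
      + (x.2 : ℂ) • ContinuousLinearMap.snd ℂ ℂ ℂ))) z :=
  (((hasFDerivAt_fst.const_mul (x.1 : ℂ)).add
    (hasFDerivAt_snd.const_mul (x.2 : ℂ))).const_mul Complex.I).cexp

variable {σ : ℝ} {u : ℤ × ℤ → ℂ}

lemma norm_mul_torusExp_le (x : ℤ × ℤ) {z : ℂ × ℂ} (hz : z ∈ closedStrip σ ×ˢ closedStrip σ) :
    ‖u x * torusExp x z‖ ≤ ‖u x‖ * Real.exp (σ * (|(x.1 : ℝ)| + |(x.2 : ℝ)|)) := by
  rw [norm_mul]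
  gcongr
  exact norm_torusExp_le x hz

lemma continuousOn_torusSeries
    (hu : Summable fun x => ‖u x‖ * Real.exp (σ * (|(x.1 : ℝ)| + |(x.2 : ℝ)|))) :
    ContinuousOn (torusSeries u) (closedStrip σ ×ˢ closedStrip σ) :=
  continuousOn_tsum (fun x => by fun_prop) hu fun x _ hz => norm_mul_torusExp_le x hz

lemma hasFDerivAt_torusSeries
    (hu : Summable fun x => ‖u x‖ * Real.exp (σ * (|(x.1 : ℝ)| + |(x.2 : ℝ)|)))
    {z : ℂ × ℂ} (hz : z ∈ openStrip σ ×ˢ openStrip σ) :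
    ∃ D : ℂ × ℂ →L[ℂ] ℂ, HasFDerivAt (torusSeries u) D z ∧
      HasSum (fun x : ℤ × ℤ => u x • torusExp x z • Complex.I •
        ((x.1 : ℂ) • ContinuousLinearMap.fst ℂ ℂ ℂ
          + (x.2 : ℂ) • ContinuousLinearMap.snd ℂ ℂ ℂ)) D := by
  obtain ⟨r, hr, hrσ⟩ := exists_between (max_lt hz.1 hz.2 : max |z.1.im| |z.2.im| < σ)
  have hzr : z ∈ openStrip r ×ˢ openStrip r :=
    ⟨(le_max_left _ _).trans_lt hr, (le_max_right _ _).trans_lt hr⟩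
  have hpos : 0 < σ - r := sub_pos.2 hrσ
  have hbound : ∀ (x : ℤ × ℤ) (w : ℂ × ℂ), w ∈ openStrip r ×ˢ openStrip r →
      ‖u x • torusExp x w • Complex.I • ((x.1 : ℂ) • ContinuousLinearMap.fst ℂ ℂ ℂ
          + (x.2 : ℂ) • ContinuousLinearMap.snd ℂ ℂ ℂ)‖
        ≤ ‖u x‖ * Real.exp (σ * (|(x.1 : ℝ)| + |(x.2 : ℝ)|)) * (σ - r)⁻¹ := by
    intro x w hw
    have h1 := norm_mul_torusExp_le (σ := r) (u := u) x
      (Set.prod_mono (openStrip_subset_closedStrip r) (openStrip_subset_closedStrip r) hw)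
    have h2 : ‖(x.1 : ℂ) • ContinuousLinearMap.fst ℂ ℂ ℂ
        + (x.2 : ℂ) • ContinuousLinearMap.snd ℂ ℂ ℂ‖ ≤ |(x.1 : ℝ)| + |(x.2 : ℝ)| := by
      refine (norm_add_le _ _).trans (add_le_add ?_ ?_)
      · rw [norm_smul, Complex.norm_intCast]
        exact mul_le_of_le_one_right (abs_nonneg _) (ContinuousLinearMap.norm_fst_le _ _ _)
      · rw [norm_smul, Complex.norm_intCast]
        exact mul_le_of_le_one_right (abs_nonneg _) (ContinuousLinearMap.norm_snd_le _ _ _)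
    have h3 : |(x.1 : ℝ)| + |(x.2 : ℝ)|
        ≤ Real.exp ((σ - r) * (|(x.1 : ℝ)| + |(x.2 : ℝ)|)) * (σ - r)⁻¹ := by
      rw [← div_eq_mul_inv, le_div_iff₀ hpos]
      linarith [Real.add_one_le_exp ((σ - r) * (|(x.1 : ℝ)| + |(x.2 : ℝ)|))]
    rw [smul_smul, norm_smul, norm_smul, Complex.norm_I, one_mul]
    calc _ ≤ ‖u x‖ * Real.exp (r * (|(x.1 : ℝ)| + |(x.2 : ℝ)|)) *
          (Real.exp ((σ - r) * (|(x.1 : ℝ)| + |(x.2 : ℝ)|)) * (σ - r)⁻¹) := by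
          gcongr
          exact h2.trans h3
      _ = ‖u x‖ * (Real.exp (r * (|(x.1 : ℝ)| + |(x.2 : ℝ)|)) *
          Real.exp ((σ - r) * (|(x.1 : ℝ)| + |(x.2 : ℝ)|))) * (σ - r)⁻¹ := by ring
      _ = _ := by
          rw [← Real.exp_add]
          congr 3
          ring
  refine ⟨_, ?_, (Summable.of_norm_bounded (hu.mul_right _) fun x => hbound x z hzr).hasSum⟩
  refine hasFDerivAt_tsum_of_isPreconnected (hu.mul_right _)
    ((isOpen_openStrip r).prod (isOpen_openStrip r))
    ((convex_openStrip r).prod (convex_openStrip r)).isPreconnected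
    (fun x w _ => (hasFDerivAt_torusExp x w).const_mul (u x)) hbound hzr ?_ hzr
  exact Summable.of_norm_bounded hu fun x => norm_mul_torusExp_le x
    (Set.prod_mono (openStrip_subset_closedStrip σ) (openStrip_subset_closedStrip σ) hz)

lemma cohomOp_torusSeries
    (hu : Summable fun x => ‖u x‖ * Real.exp (σ * (|(x.1 : ℝ)| + |(x.2 : ℝ)|))) (ω : ℝ)
    {z : ℂ × ℂ} (hz : z ∈ openStrip σ ×ˢ openStrip σ) :
    HasSum (fun x : ℤ × ℤ => u x * (Complex.I * (x.1 + ω * x.2)) * torusExp x z)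
      (cohomOp ω (torusSeries u) z) := by
  obtain ⟨D, hD, hs⟩ := hasFDerivAt_torusSeries hu hz
  have h1 := (ContinuousLinearMap.apply ℂ ℂ ((1, 0) : ℂ × ℂ)).hasSum hs
  have h2 := (ContinuousLinearMap.apply ℂ ℂ ((0, 1) : ℂ × ℂ)).hasSum hs
  have h := h1.add (h2.mul_left (ω : ℂ))
  rw [cohomOp, hD.fderiv]
  refine (congrArg (HasSum · _) (funext fun x => ?_)).mpr h
  simp
  ring

lemma torusExp_add_fst (x : ℤ × ℤ) (z : ℂ × ℂ) :
    torusExp x (z.1 + 2 * Real.pi, z.2) = torusExp x z := by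
  have e : Complex.I * (x.1 * (z.1 + 2 * Real.pi) + x.2 * z.2)
      = Complex.I * (x.1 * z.1 + x.2 * z.2) + x.1 * (2 * Real.pi * Complex.I) := by ring
  simp only [torusExp]
  rw [e]
  exact Complex.exp_periodic.int_mul x.1 _

lemma torusExp_add_snd (x : ℤ × ℤ) (z : ℂ × ℂ) :
    torusExp x (z.1, z.2 + 2 * Real.pi) = torusExp x z := by
  have e : Complex.I * (x.1 * z.1 + x.2 * (z.2 + 2 * Real.pi))
      = Complex.I * (x.1 * z.1 + x.2 * z.2) + x.2 * (2 * Real.pi * Complex.I) := by ring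
  simp only [torusExp]
  rw [e]
  exact Complex.exp_periodic.int_mul x.2 _

lemma conj_torusExp (x : ℤ × ℤ) (s t : ℝ) :
    (starRingEnd ℂ) (torusExp x (s, t)) = torusExp (-x) (s, t) := by
  rw [torusExp, torusExp, ← Complex.exp_conj]
  congr 1
  simp
  ring

lemma conj_torusSeries (hconj : ∀ x, u (-x) = (starRingEnd ℂ) (u x)) (s t : ℝ) :
    (starRingEnd ℂ) (torusSeries u (s, t)) = torusSeries u (s, t) := by
  rw [torusSeries, Complex.conj_tsum, ← (Equiv.neg (ℤ × ℤ)).tsum_eq]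
  refine tsum_congr fun x => ?_
  simp only [Equiv.neg_apply, map_mul, conj_torusExp, neg_neg, hconj, Complex.conj_conj]

lemma integral_exp_int {n : ℤ} (hn : n ≠ 0) :
    ∫ t in (0 : ℝ)..(2 * Real.pi), Complex.exp (Complex.I * (n * t)) = 0 := by
  have hc : Complex.I * n ≠ 0 := mul_ne_zero Complex.I_ne_zero (by exact_mod_cast hn)
  simp only [← mul_assoc]
  rw [integral_exp_mul_complex hc]
  have e : Complex.I * n * ((2 * Real.pi : ℝ) : ℂ) = n * (2 * Real.pi * Complex.I) := by
    push_cast; ring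
  rw [e, Complex.exp_int_mul_two_pi_mul_I]
  simp

lemma integral_torusSeries (hu : Summable fun x => ‖u x‖) (h0 : u 0 = 0) :
    ∫ s in (0 : ℝ)..(2 * Real.pi), ∫ t in (0 : ℝ)..(2 * Real.pi),
      torusSeries u ((s : ℂ), (t : ℂ)) = 0 := by
  have hnorm : ∀ (x : ℤ × ℤ) (s t : ℝ), ‖u x * torusExp x (s, t)‖ ≤ ‖u x‖ := fun x s t => by
    rw [norm_mul, norm_torusExp]
    simp
  have hinner : ∀ s : ℝ, HasSum
      (fun x => ∫ t in (0 : ℝ)..(2 * Real.pi), u x * torusExp x (s, t))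
      (∫ t in (0 : ℝ)..(2 * Real.pi), torusSeries u (s, t)) := fun s =>
    intervalIntegral.hasSum_integral_of_dominated_convergence (fun x _ => ‖u x‖)
      (fun x => (Continuous.aestronglyMeasurable (by fun_prop)))
      (fun x => .of_forall fun t _ => hnorm x s t) (.of_forall fun _ _ => hu)
      (by simp)
      (.of_forall fun t _ => (Summable.of_norm_bounded hu fun x => hnorm x s t).hasSum)
  have houter := intervalIntegral.hasSum_integral_of_dominated_convergence
    (a := 0) (b := 2 * Real.pi) (μ := MeasureTheory.volume)
    (F := fun x (s : ℝ) => ∫ t in (0 : ℝ)..(2 * Real.pi), u x * torusExp x (s, t))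
    (f := fun s : ℝ => ∫ t in (0 : ℝ)..(2 * Real.pi), torusSeries u (s, t))
    (fun x _ => ‖u x‖ * |2 * Real.pi - 0|)
    (fun x => (intervalIntegral.continuous_parametric_intervalIntegral_of_continuous'
      (by fun_prop) _ _).aestronglyMeasurable)
    (fun x => .of_forall fun s _ =>
      intervalIntegral.norm_integral_le_of_norm_le_const fun t _ => hnorm x s t)
    (.of_forall fun _ _ => hu.mul_right _) (by simp) (.of_forall fun s _ => hinner s)
  refine houter.unique ((congrArg (HasSum · _) (funext fun x => ?_)).mpr hasSum_zero)
  simp only [torusExp_eq_mul, intervalIntegral.integral_const_mul,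
    intervalIntegral.integral_mul_const]
  rcases eq_or_ne x.1 0 with h1 | h1
  · rcases eq_or_ne x.2 0 with h2 | h2
    · rw [show x = 0 from Prod.ext h1 h2, h0, zero_mul]
    · rw [integral_exp_int h2]; simp
  · rw [integral_exp_int h1]; simp

lemma memP0_torusSeries
    (hu : Summable fun x => ‖u x‖ * Real.exp (σ * (|(x.1 : ℝ)| + |(x.2 : ℝ)|))) (hσ : 0 ≤ σ)
    (h0 : u 0 = 0) (hconj : ∀ x, u (-x) = (starRingEnd ℂ) (u x)) :
    MemP0 σ (torusSeries u) where
  contOn := continuousOn_torusSeries hu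
  diffOn z hz := by
    obtain ⟨D, hD, -⟩ := hasFDerivAt_torusSeries hu hz
    exact hD.differentiableAt.differentiableWithinAt
  periodic_fst z := by simp only [torusSeries, torusExp_add_fst]
  periodic_snd z := by simp only [torusSeries, torusExp_add_snd]
  real_on_real s t := Complex.conj_eq_iff_im.1 (conj_torusSeries hconj s t)
  zero_avg := by
    refine integral_torusSeries (Summable.of_nonneg_of_le (fun _ => norm_nonneg _) (fun x => ?_) hu)
      h0
    exact le_mul_of_one_le_right (norm_nonneg _) (Real.one_le_exp (by positivity))

lemma supNorm_torusSeries_le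
    (hu : Summable fun x => ‖u x‖ * Real.exp (σ * (|(x.1 : ℝ)| + |(x.2 : ℝ)|))) (hσ : 0 ≤ σ) :
    supNorm σ (torusSeries u)
      ≤ ∑' x : ℤ × ℤ, ‖u x‖ * Real.exp (σ * (|(x.1 : ℝ)| + |(x.2 : ℝ)|)) := by
  have : Nonempty (closedStrip σ ×ˢ closedStrip σ : Set (ℂ × ℂ)) :=
    ⟨⟨0, by simpa [closedStrip] using hσ⟩⟩
  exact ciSup_le fun z => tsum_of_norm_bounded hu.hasSum fun x => norm_mul_torusExp_le x z.2

end Series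

section Solution

variable {ρ : ℝ} {a : ℂ × ℂ → ℂ}

lemma MemP0.torusCoeff_zero (ha : MemP0 ρ a) (hρ : 0 < ρ) :
    torusCoeff (fun s t => a (s, t)) 0 = 0 := by
  have h0 : |(0 : ℝ)| < ρ := by simpa using hρ
  have hc := (ha.continuous_shift h0 h0).comp continuous_swap
  simp only [Complex.ofReal_zero, zero_mul, add_zero] at hc
  have h := integral_integral_swap_of_continuous (f := fun t s : ℝ => a (s, t)) hc
    0 (2 * Real.pi) 0 (2 * Real.pi)
  rw [ha.zero_avg] at h
  rw [torusCoeff_eq]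
  simp [torusExp, h]

lemma MemP0.torusCoeff_neg (ha : MemP0 ρ a) (x : ℤ × ℤ) :
    torusCoeff (fun s t => a (s, t)) (-x)
      = (starRingEnd ℂ) (torusCoeff (fun s t => a (s, t)) x) := by
  have hreal : ∀ s t : ℝ, (starRingEnd ℂ) (a (s, t)) = a (s, t) := fun s t =>
    Complex.conj_eq_iff_im.2 (ha.real_on_real s t)
  rw [torusCoeff_eq, torusCoeff_eq, map_mul, ← intervalIntegral.intervalIntegral_conj]
  simp only [← intervalIntegral.intervalIntegral_conj, map_mul, hreal, conj_torusExp, neg_neg]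
  simp [map_ofNat (starRingEnd ℂ) 2]

lemma add_mul_intCast_ne_zero {ω : ℝ} (hirr : Irrational ω) {x : ℤ × ℤ} (hx : x ≠ 0) :
    (x.1 : ℝ) + ω * x.2 ≠ 0 := by
  intro h
  rcases eq_or_ne x.2 0 with h2 | h2
  · rw [h2] at h
    exact hx (Prod.ext (by exact_mod_cast (by simpa using h : (x.1 : ℝ) = 0)) h2)
  · have := (hirr.mul_intCast h2).ne_int (-x.1)
    apply this
    push_cast
    linarith

/-- The Fourier coefficients of the solution of the cohomological equation. -/
noncomputable def solutionCoeff (ω : ℝ) (a : ℂ × ℂ → ℂ) (x : ℤ × ℤ) : ℂ :=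
  torusCoeff (fun s t => a (s, t)) x / (Complex.I * (x.1 + ω * x.2))

lemma MemP0.norm_solutionCoeff_mul_exp_le (ha : MemP0 ρ a) (hρ : 0 < ρ) (ω δ : ℝ) (x : ℤ × ℤ) :
    ‖solutionCoeff ω a x‖ * Real.exp ((ρ - δ) * (|(x.1 : ℝ)| + |(x.2 : ℝ)|))
      ≤ supNorm ρ a * divisorWeight ω δ x := by
  have h := ha.norm_torusCoeff_le hρ (fun z hz => ha.norm_le_supNorm hz) x
  have hn : ‖Complex.I * ((x.1 : ℂ) + ω * x.2)‖ = |(x.1 : ℝ) + ω * x.2| := by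
    rw [norm_mul, Complex.norm_I, one_mul, ← Real.norm_eq_abs, ← Complex.norm_real]
    push_cast
    rfl
  rw [solutionCoeff, norm_div, hn, divisorWeight, div_mul_eq_mul_div, ← mul_div_assoc]
  refine div_le_div_of_nonneg_right ?_ (abs_nonneg _)
  calc _ ≤ supNorm ρ a * Real.exp (-ρ * (|(x.1 : ℝ)| + |(x.2 : ℝ)|))
        * Real.exp ((ρ - δ) * (|(x.1 : ℝ)| + |(x.2 : ℝ)|)) := by gcongr
    _ = _ := by
      rw [mul_assoc, ← Real.exp_add]
      congr 2
      ring

lemma MemP0.solutionCoeff_neg (ha : MemP0 ρ a) (ω : ℝ) (x : ℤ × ℤ) :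
    solutionCoeff ω a (-x) = (starRingEnd ℂ) (solutionCoeff ω a x) := by
  rw [solutionCoeff, solutionCoeff, ha.torusCoeff_neg, map_div₀]
  congr 1
  simp
  ring

lemma MemP0.exists_solution (ha : MemP0 ρ a) {ω δ : ℝ} (hirr : Irrational ω) (hδ : 0 < δ)
    (hδρ : δ < ρ) (hs : Summable (divisorWeight ω δ)) :
    ∃ g : ℂ × ℂ → ℂ, MemP0 (ρ - δ) g ∧
      (∀ z ∈ openStrip (ρ - δ) ×ˢ openStrip (ρ - δ), cohomOp ω g z = a z) ∧
      supNorm (ρ - δ) g ≤ (∑' x, divisorWeight ω δ x) * supNorm ρ a := by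
  have hρ : 0 < ρ := hδ.trans hδρ
  have hσ : 0 ≤ ρ - δ := sub_nonneg.2 hδρ.le
  have hle := ha.norm_solutionCoeff_mul_exp_le hρ ω δ
  have hu := Summable.of_nonneg_of_le (fun _ => by positivity) hle (hs.mul_left _)
  have hc0 := ha.torusCoeff_zero hρ
  refine ⟨torusSeries (solutionCoeff ω a),
    memP0_torusSeries hu hσ (by simp [solutionCoeff]) (ha.solutionCoeff_neg ω), ?_, ?_⟩
  · intro z hz
    have hz' : z ∈ openStrip ρ ×ˢ openStrip ρ :=
      ⟨hz.1.trans (sub_lt_self ρ hδ), hz.2.trans (sub_lt_self ρ hδ)⟩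
    refine (cohomOp_torusSeries hu ω hz).unique
      ((congrArg (HasSum · _) (funext fun x => ?_)).mpr (ha.hasSum hz'))
    congr 1
    rcases eq_or_ne x 0 with rfl | hx
    · simp [hc0]
    · refine div_mul_cancel₀ _ (mul_ne_zero Complex.I_ne_zero ?_)
      exact_mod_cast add_mul_intCast_ne_zero hirr hx
  · rw [mul_comm, ← tsum_mul_left]
    exact (supNorm_torusSeries_le hu hσ).trans (hu.tsum_le_tsum hle (hs.mul_left _))

end Solution

/-- existence and bound for the solution of the cohomological equation under the
semi-Brjuno condition. There are constants `K₁, K₂ > 0` and `δ₀ ∈ (0,1)` depending only on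
`ω` such that for all `ρ > 0`, `δ ∈ (0, min(ρ, δ₀))` and `a ∈ 𝒫₀(ρ)`, if `Δ = (1+ω)δ`
satisfies `𝔅rj₁(Δ) < ∞` and `𝔅rj₂(2Δ) < ∞`, then there is `g ∈ 𝒫₀(ρ-δ)` with
`(∂_x + ω∂_y) g = a` on the open bi-strip and
`‖g‖_{ρ-δ} ≤ (4e^δ 𝔅rj₁(Δ) + 2e^δ 𝔅rj₂(2Δ) + K₁ δ⁻² + K₂ δ⁻¹ log δ⁻¹) ‖a‖_ρ`. -/
theorem solution_of_cohomological_equation (ω : ℝ) (hirr : Irrational ω)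
    (hω0 : 0 < ω) (hω1 : ω < 1) :
    ∃ K₁ K₂ δ₀ : ℝ, 0 < K₁ ∧ 0 < K₂ ∧ 0 < δ₀ ∧ δ₀ < 1 ∧
      ∀ ρ : ℝ, 0 < ρ → ∀ δ : ℝ, 0 < δ → δ < min ρ δ₀ →
        ∀ a : ℂ × ℂ → ℂ, MemP0 ρ a →
          Brj1 ω ((1 + ω) * δ) ≠ ⊤ → Brj2 ω (2 * ((1 + ω) * δ)) ≠ ⊤ →
            ∃ g : ℂ × ℂ → ℂ, MemP0 (ρ - δ) g ∧
              (∀ z ∈ openStrip (ρ - δ) ×ˢ openStrip (ρ - δ), cohomOp ω g z = a z) ∧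
              supNorm (ρ - δ) g ≤
                (4 * Real.exp δ * (Brj1 ω ((1 + ω) * δ)).toReal
                  + 2 * Real.exp δ * (Brj2 ω (2 * ((1 + ω) * δ))).toReal
                  + K₁ * δ⁻¹ ^ 2 + K₂ * δ⁻¹ * Real.log δ⁻¹) * supNorm ρ a := by
  refine ⟨64 + 8 / ω, 1, 1 / 2, by positivity, one_pos, by norm_num, by norm_num, ?_⟩
  intro ρ hρ δ hδ hδlt a ha hB1 hB2
  have hδρ : δ < ρ := hδlt.trans_le (min_le_left _ _)
  have hδ1 : δ ≤ 1 := (hδlt.trans_le (min_le_right _ _)).le.trans (by norm_num)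
  obtain ⟨hs, hle⟩ := summable_divisorWeight_and_tsum_le hirr hω0 hω1 hδ hδ1 hB1 hB2
  obtain ⟨g, hg, hga, hgle⟩ := ha.exists_solution hirr hδ hδρ hs
  refine ⟨g, hg, hga, hgle.trans ?_⟩
  have hlog : 0 ≤ 1 * δ⁻¹ * Real.log δ⁻¹ :=
    mul_nonneg (by positivity) (Real.log_nonneg ((one_le_inv₀ hδ).2 hδ1))
  have hM : 0 ≤ supNorm ρ a := Real.iSup_nonneg fun z => norm_nonneg _
  gcongr
  linarith
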